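/- arXiv:2209.05897 — 2 statements merged into one kernel-verified Lean document; each statement's English description precedes it below -/
import Mathlib

section
/- Let a ∈ ℝ and 1 < p, q, r < ∞. Then the Banach space (HL^{a,r}_{p,q}(Ω), ‖·‖*_{HL^{a,r}_{p,q}}) is reflexive. -/
open MeasureTheory ENNReal Set Filter Topology

noncomputable section

variable {X : Type*}

/-- The decreasing rearrangement `f*` of `f` with respect to `μ` :
`f*(s) = inf {α ≥ 0 : μ({x : |f(x)| > α}) ≤ s}`. -/
def rearr [MeasurableSpace X] (μ : Measure X) (f : X → ℝ) (s : ℝ) : ℝ≥0∞ :=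
  sInf {α : ℝ≥0∞ | μ {x | α < ENNReal.ofReal |f x|} ≤ ENNReal.ofReal s}

/-- The averaged (maximal) rearrangement `f**(s) = (1/s)∫_0^s f*(t) dt`. -/
def rearrStar [MeasurableSpace X] (μ : Measure X) (f : X → ℝ) (s : ℝ) : ℝ≥0∞ :=
  (ENNReal.ofReal s)⁻¹ * ∫⁻ t in Set.Ioc (0 : ℝ) s, rearr μ f t

/-- The Lorentz functional built from a rearrangement-type function `R`:
`(∫_0^∞ (t^{1/p} R(t))^r dt/t)^{1/r}` for `r < ∞`, and `sup_{t>0} t^{1/p} R(t)`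
for `r = ∞` (when `p = ∞`, `1/p` is interpreted as `0`, which for `R = f*`
recovers the essential supremum of `|f|`). -/
def lorentzNormOf (R : ℝ → ℝ≥0∞) (p r : ℝ≥0∞) : ℝ≥0∞ :=
  if r = ∞ then ⨆ t : {t : ℝ // 0 < t}, ENNReal.ofReal (t.1 ^ p.toReal⁻¹) * R t.1
  else (∫⁻ t in Set.Ioi (0 : ℝ),
      (ENNReal.ofReal (t ^ p.toReal⁻¹) * R t) ^ r.toReal / ENNReal.ofReal t) ^ r.toReal⁻¹

/-- The Lorentz quasi-norm `‖f‖_{L^{p,r}}`. -/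
def lorentzNorm [MeasurableSpace X] (μ : Measure X) (p r : ℝ≥0∞) (f : X → ℝ) : ℝ≥0∞ :=
  lorentzNormOf (rearr μ f) p r

/-- The Lorentz norm `‖f‖*_{L^{p,r}}`, with `f*` replaced by `f**`. -/
def lorentzNormStar [MeasurableSpace X] (μ : Measure X) (p r : ℝ≥0∞) (f : X → ℝ) : ℝ≥0∞ :=
  lorentzNormOf (rearrStar μ f) p r

/-- The annuli `A_u`, `u ≥ -1`:  `A_{-1} = {x ∈ Ω : |x| < 1/2}` and, for `u ≥ 0`,
`A_u = {x ∈ Ω : 2^{u-1} ≤ |x| < 2^u}`. -/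
def annulus [Norm X] (Ω : Set X) (u : ℤ) : Set X :=
  if u = -1 then {x ∈ Ω | ‖x‖ < 1 / 2}
  else {x ∈ Ω | (2 : ℝ) ^ (u - 1) ≤ ‖x‖ ∧ ‖x‖ < (2 : ℝ) ^ u}

/-- The Herz-type functional built from a functional `L` on the blocks:
`(Σ_{u ≥ -1} (2^{ua} L(f χ_{A_u}))^q)^{1/q}` for `q < ∞`, with the sup-modification
for `q = ∞`. -/
def herzNormWith {E : Type*} [Norm X] [Zero E] (Ω : Set X) (a : ℝ) (q : ℝ≥0∞)
    (L : (X → E) → ℝ≥0∞) (f : X → E) : ℝ≥0∞ :=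
  if q = ∞ then
    ⨆ u : {u : ℤ // -1 ≤ u},
      ENNReal.ofReal ((2 : ℝ) ^ ((u.1 : ℝ) * a)) * L ((annulus Ω u.1).indicator f)
  else (∑' u : {u : ℤ // -1 ≤ u},
      (ENNReal.ofReal ((2 : ℝ) ^ ((u.1 : ℝ) * a)) * L ((annulus Ω u.1).indicator f)) ^ q.toReal)
      ^ q.toReal⁻¹

/-- The non-homogeneous Lorentz–Herz quasi-norm `‖f‖_{HL^{a,r}_{p,q}}`. -/
def herzNorm [MeasurableSpace X] [Norm X] (μ : Measure X) (Ω : Set X) (a : ℝ)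
    (p q r : ℝ≥0∞) (f : X → ℝ) : ℝ≥0∞ :=
  herzNormWith Ω a q (lorentzNorm μ p r) f

/-- The non-homogeneous Lorentz–Herz norm `‖f‖*_{HL^{a,r}_{p,q}}`, built from the
Lorentz norms `‖·‖*_{L^{p,r}}`. -/
def herzNormStar [MeasurableSpace X] [Norm X] (μ : Measure X) (Ω : Set X) (a : ℝ)
    (p q r : ℝ≥0∞) (f : X → ℝ) : ℝ≥0∞ :=
  herzNormWith Ω a q (lorentzNormStar μ p r) f

/-- The conjugate exponent: `1/p + 1/p' = 1`, with `1' = ∞` and `∞' = 1`. -/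
def conjExp (p : ℝ≥0∞) : ℝ≥0∞ :=
  if p = 1 then ∞ else if p = ∞ then 1 else ENNReal.ofReal (p.toReal / (p.toReal - 1))

/-- The quantity `(Σ_{u≥-1} (2^{ua} μ(A_u ∩ E)^{1/p})^q)^{(of the summands)}`,
i.e. `Σ_{u≥-1} 2^{uaq} μ(A_u ∩ E)^{q/p}` for `q < ∞`, with the sup-modification
for `q = ∞`. -/
def herzSetNorm [MeasurableSpace X] [Norm X] (μ : Measure X) (Ω : Set X) (a : ℝ)
    (p q : ℝ≥0∞) (E : Set X) : ℝ≥0∞ :=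
  if q = ∞ then
    ⨆ u : {u : ℤ // -1 ≤ u},
      ENNReal.ofReal ((2 : ℝ) ^ ((u.1 : ℝ) * a)) * μ (annulus Ω u.1 ∩ E) ^ p.toReal⁻¹
  else ∑' u : {u : ℤ // -1 ≤ u},
      (ENNReal.ofReal ((2 : ℝ) ^ ((u.1 : ℝ) * a)) * μ (annulus Ω u.1 ∩ E) ^ p.toReal⁻¹) ^ q.toReal

/-- The Peetre K-functional for the couple of quasi-normed function spaces
determined by the functionals `n₀`, `n₁`. -/
def Kfun [MeasurableSpace X] (n₀ n₁ : (X → ℝ) → ℝ≥0∞) (t : ℝ) (f : X → ℝ) : ℝ≥0∞ :=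
  ⨅ (g : X → ℝ) (_ : Measurable g) (_ : Measurable (f - g)),
    n₀ g + ENNReal.ofReal t * n₁ (f - g)

/-- The real interpolation quasi-norm `‖f‖_{(X₀,X₁)_{θ,q}}`. -/
def interpNorm [MeasurableSpace X] (n₀ n₁ : (X → ℝ) → ℝ≥0∞) (θ : ℝ) (q : ℝ≥0∞)
    (f : X → ℝ) : ℝ≥0∞ :=
  if q = ∞ then ⨆ t : {t : ℝ // 0 < t}, ENNReal.ofReal (t.1 ^ (-θ)) * Kfun n₀ n₁ t.1 f
  else (∫⁻ t in Set.Ioi (0 : ℝ),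
      (ENNReal.ofReal (t ^ (-θ)) * Kfun n₀ n₁ t f) ^ q.toReal / ENNReal.ofReal t) ^ q.toReal⁻¹

/-- Membership in the sum `X₀ + X₁` of the couple determined by `n₀`, `n₁`. -/
def inSum [MeasurableSpace X] (n₀ n₁ : (X → ℝ) → ℝ≥0∞) (f : X → ℝ) : Prop :=
  ∃ g : X → ℝ, Measurable g ∧ Measurable (f - g) ∧ n₀ g < ∞ ∧ n₁ (f - g) < ∞

end
abbrev Euc (N : ℕ) : Type := EuclideanSpace ℝ (Fin N)


section helpers
open scoped ENNReal

variable {X : Type*} [MeasurableSpace X]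

noncomputable def Phi (μ : Measure X) (g : X → ℝ) (t : ℝ) : ℝ≥0∞ := ∫⁻ s in Set.Ioc (0:ℝ) t, rearr μ g s

lemma vol_aux (c : ℝ≥0∞) : volume ({α : ℝ | ENNReal.ofReal α < c} ∩ Ioi 0) = c := by
  by_cases hc : c = ∞
  · subst hc
    have : {α : ℝ | ENNReal.ofReal α < ∞} ∩ Ioi 0 = Ioi 0 := by
      ext; simp
    rw [this, Real.volume_Ioi]
  · have : {α : ℝ | ENNReal.ofReal α < c} ∩ Ioi 0 = Ioo 0 c.toReal := by
      ext x
      simp only [mem_inter_iff, mem_ofPred_eq, mem_Ioi, mem_Ioo]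
      constructor
      · rintro ⟨h1, h2⟩
        exact ⟨h2, (ENNReal.ofReal_lt_iff_lt_toReal h2.le hc).1 h1⟩
      · rintro ⟨h1, h2⟩
        exact ⟨(ENNReal.ofReal_lt_iff_lt_toReal h1.le hc).2 h2, h1⟩
    rw [this, Real.volume_Ioo, sub_zero, ENNReal.ofReal_toReal hc]

lemma vol_aux2 (t : ℝ) (c : ℝ≥0∞) :
    volume ({α : ℝ | ENNReal.ofReal α < c} ∩ Ioc 0 t) = min (ENNReal.ofReal t) c := by
  by_cases hc : c = ∞
  · subst hc
    have : {α : ℝ | ENNReal.ofReal α < ∞} ∩ Ioc 0 t = Ioc 0 t := by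
      ext; simp
    rw [this, Real.volume_Ioc]; simp
  · have e1 : min (ENNReal.ofReal t) c = ENNReal.ofReal (min t c.toReal) := by
      rw [ENNReal.ofReal_min, ENNReal.ofReal_toReal hc]
    rw [e1]
    apply le_antisymm
    · calc _ ≤ volume (Ioc 0 (min t c.toReal)) := by
            apply measure_mono
            rintro x ⟨h1, h2, h3⟩
            exact ⟨h2, le_min h3 ((ENNReal.ofReal_lt_iff_lt_toReal h2.le hc).1 h1).le⟩
        _ = _ := by simp
    · calc ENNReal.ofReal (min t c.toReal) = volume (Ioo 0 (min t c.toReal)) := by simp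
        _ ≤ _ := by
            apply measure_mono
            rintro x ⟨h1, h2⟩
            rw [lt_min_iff] at h2
            exact ⟨(ENNReal.ofReal_lt_iff_lt_toReal h1.le hc).2 h2.2, h1, h2.1.le⟩

lemma layer {Y : Type*} [MeasurableSpace Y] (ν : Measure Y) [SFinite ν] {F : Y → ℝ≥0∞}
    (hF : Measurable F) :
    ∫⁻ x, F x ∂ν = ∫⁻ α in Ioi (0:ℝ), ν {x | ENNReal.ofReal α < F x} := by
  have hS : MeasurableSet {z : Y × ℝ | ENNReal.ofReal z.2 < F z.1} :=
    measurableSet_lt (ENNReal.measurable_ofReal.comp measurable_snd) (hF.comp measurable_fst)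
  have h1 := Measure.prod_apply (μ := ν) (ν := volume.restrict (Ioi (0:ℝ))) hS
  have h2 := Measure.prod_apply_symm (μ := ν) (ν := volume.restrict (Ioi (0:ℝ))) hS
  rw [h1] at h2
  simp only [preimage_ofPred_eq] at h2
  rw [← h2]
  apply lintegral_congr
  intro x
  rw [Measure.restrict_apply (measurableSet_lt ENNReal.measurable_ofReal measurable_const), vol_aux]

lemma lt_rearr (μ : Measure X) (g : X → ℝ) (s : ℝ) (α : ℝ≥0∞) :
    α < rearr μ g s ↔ ENNReal.ofReal s < μ {x | α < ENNReal.ofReal |g x|} := by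
  constructor
  · intro h
    by_contra h2
    push Not at h2
    exact absurd (sInf_le (a := α) h2) (not_le.2 h)
  · intro h
    by_contra h2
    push Not at h2
    apply absurd h
    push Not
    have hne : ({α : ℝ≥0∞ | μ {x | α < ENNReal.ofReal |g x|} ≤ ENNReal.ofReal s}).Nonempty :=
      ⟨⊤, by simp⟩
    obtain ⟨u, hu1, hu2, hu3⟩ := exists_seq_tendsto_sInf hne (OrderBot.bddBelow _)
    calc μ {x | α < ENNReal.ofReal |g x|} ≤ μ (⋃ n, {x | u n < ENNReal.ofReal |g x|}) := by
          apply measure_mono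
          intro x hx
          have : rearr μ g s < ENNReal.ofReal |g x| := lt_of_le_of_lt h2 hx
          obtain ⟨n, hn⟩ := (hu2.eventually_lt_const this).exists
          exact mem_iUnion.2 ⟨n, hn⟩
      _ = ⨆ n, μ {x | u n < ENNReal.ofReal |g x|} := by
          apply Monotone.measure_iUnion
          intro a b hab x hx
          exact lt_of_le_of_lt (hu1 hab) hx
      _ ≤ _ := iSup_le fun n => hu3 n

lemma rearr_anti (μ : Measure X) (g : X → ℝ) : Antitone (rearr μ g) := by
  intro a b hab
  apply sInf_le_sInf
  intro α hα
  exact le_trans hα (ENNReal.ofReal_le_ofReal hab)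

lemma Phi_layer (μ : Measure X) (g : X → ℝ) (t : ℝ) :
    Phi μ g t = ∫⁻ α in Ioi (0:ℝ), min (ENNReal.ofReal t)
      (μ {x | ENNReal.ofReal α < ENNReal.ofReal |g x|}) := by
  have hm : Measurable (rearr μ g) := (rearr_anti μ g).measurable
  rw [Phi, layer _ hm]
  apply lintegral_congr
  intro α
  rw [Measure.restrict_apply (measurableSet_lt measurable_const hm)]
  simp only [lt_rearr]
  rw [vol_aux2]

lemma Phi_mono (μ : Measure X) (g : X → ℝ) : Monotone (Phi μ g) := by
  intro a b hab
  exact lintegral_mono_set (Ioc_subset_Ioc_right hab)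

lemma lint_phi_layer (μ : Measure X) [SFinite μ] {g : X → ℝ} (hg : Measurable g) {φ : X → ℝ≥0∞}
    (hφ : Measurable φ) :
    ∫⁻ x, φ x * ENNReal.ofReal |g x| ∂μ =
      ∫⁻ α in Ioi (0:ℝ), ∫⁻ x in {x | ENNReal.ofReal α < ENNReal.ofReal |g x|}, φ x ∂μ := by
  have hG : Measurable fun x => ENNReal.ofReal |g x| := by fun_prop
  have := layer (μ.withDensity φ) hG
  rw [lintegral_withDensity_eq_lintegral_mul _ hφ hG] at this
  simp only [Pi.mul_apply] at this
  rw [this]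
  apply lintegral_congr
  intro α
  rw [withDensity_apply _ (measurableSet_lt measurable_const hG)]

lemma Phi_ge (μ : Measure X) [SFinite μ] {g : X → ℝ} (hg : Measurable g) {φ : X → ℝ≥0∞}
    (hφ : Measurable φ) (h1 : ∀ x, φ x ≤ 1) {t : ℝ} (ht : ∫⁻ x, φ x ∂μ ≤ ENNReal.ofReal t) :
    ∫⁻ x, φ x * ENNReal.ofReal |g x| ∂μ ≤ Phi μ g t := by
  rw [lint_phi_layer μ hg hφ, Phi_layer]
  apply lintegral_mono
  intro α
  apply le_min
  · exact (setLIntegral_le_lintegral _ _).trans ht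
  · calc _ ≤ ∫⁻ x in {x | ENNReal.ofReal α < ENNReal.ofReal |g x|}, 1 ∂μ :=
          lintegral_mono fun x => h1 x
      _ = _ := by simp

lemma Phi_att (μ : Measure X) [SFinite μ] {g : X → ℝ} (hg : Measurable g)
    (hfin : μ {x | g x ≠ 0} ≠ ∞) (t : ℝ) :
    ∃ φ : X → ℝ≥0∞, Measurable φ ∧ (∀ x, φ x ≤ 1) ∧ ∫⁻ x, φ x ∂μ ≤ ENNReal.ofReal t ∧
      Phi μ g t = ∫⁻ x, φ x * ENNReal.ofReal |g x| ∂μ := by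
  have hG : Measurable fun x => ENNReal.ofReal |g x| := by fun_prop
  set l := rearr μ g t with hl
  set G := fun x => ENNReal.ofReal |g x| with hGdef
  have hd : μ {x | l < G x} ≤ ENNReal.ofReal t := by
    have := (lt_rearr μ g t l).not
    simpa [hl] using this
  have hsub : ∀ α : ℝ≥0∞, {x | α < G x} ⊆ {x | g x ≠ 0} := by
    intro α x hx h0
    simp [hGdef, h0] at hx
  have hA : MeasurableSet {x | l < G x} := measurableSet_lt measurable_const hG
  have hB : MeasurableSet {x | G x = l} := hG (measurableSet_singleton l)
  have key : ∃ θ : ℝ≥0∞, θ ≤ 1 ∧ μ {x | l < G x} + θ * μ {x | G x = l} ≤ ENNReal.ofReal t ∧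
      (0 < l → μ {x | l < G x} + θ * μ {x | G x = l} = ENNReal.ofReal t) := by
    by_cases hl0 : 0 < l
    · have h2 : ENNReal.ofReal t ≤ μ {x | l < G x} + μ {x | G x = l} := by
        have e : μ {x | l < G x} + μ {x | G x = l} = μ {x | l ≤ G x} := by
          rw [← measure_union _ hB]
          · congr 1; ext x; simp [le_iff_lt_or_eq, eq_comm]
          · rw [Set.disjoint_left]; intro x hx hx2; simp at hx hx2; exact absurd hx2 hx.ne'
        rw [e]
        obtain ⟨v, hv1, hv2, hv3⟩ := exists_seq_strictMono_tendsto' hl0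
        have : {x | l ≤ G x} = ⋂ n, {x | v n < G x} := by
          ext x
          simp only [mem_ofPred_eq, mem_iInter]
          constructor
          · intro h n; exact (hv2 n).2.trans_le h
          · intro h; exact le_of_tendsto' hv3 fun n => (h n).le
        rw [this, Antitone.measure_iInter]
        · refine le_iInf fun n => ?_
          exact ((lt_rearr μ g t (v n)).1 (hv2 n).2).le
        · intro a b hab x hx; exact lt_of_le_of_lt (hv1.monotone hab) hx
        · intro n; exact (measurableSet_lt measurable_const hG).nullMeasurableSet
        · exact ⟨0, measure_ne_top_of_subset (hsub _) hfin⟩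
      have hBf : μ {x | G x = l} ≠ ∞ := by
        apply measure_ne_top_of_subset _ hfin
        intro x hx h0
        simp only [mem_ofPred_eq, hGdef, h0] at hx
        simp at hx
        exact hl0.ne hx
      by_cases hB0 : μ {x | G x = l} = 0
      · refine ⟨0, by simp, ?_, fun _ => ?_⟩
        · simpa using hd
        · rw [hB0, add_zero] at h2
          simpa using le_antisymm hd h2
      · refine ⟨(ENNReal.ofReal t - μ {x | l < G x}) / μ {x | G x = l}, ?_, ?_⟩
        · apply ENNReal.div_le_of_le_mul
          rw [one_mul]
          exact tsub_le_iff_left.2 h2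
        · rw [ENNReal.div_mul_cancel hB0 hBf, add_tsub_cancel_of_le hd]
          simp
    · exact ⟨0, by simp, by simpa using hd, fun h => absurd h hl0⟩
  obtain ⟨θ, hθ1, hθ2, hθ3⟩ := key
  let φ : X → ℝ≥0∞ := {x | l < G x}.indicator 1 + {x | G x = l}.indicator (fun _ => θ)
  have hφm : Measurable φ := by
    apply Measurable.add
    · exact measurable_one.indicator hA
    · exact measurable_const.indicator hB
  have hintg : ∫⁻ x, φ x ∂μ = μ {x | l < G x} + θ * μ {x | G x = l} := by
    simp only [φ, Pi.add_apply]
    rw [lintegral_add_left (measurable_one.indicator hA), lintegral_indicator_one hA,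
      lintegral_indicator_const hB]
  have h1 : ∀ x, φ x ≤ 1 := by
    intro x
    simp only [φ, Pi.add_apply, indicator_apply, mem_ofPred_eq, Pi.one_apply]
    by_cases h : l < G x
    · simp [h, h.ne']
    · simp only [h, if_false, zero_add]
      split_ifs
      · exact hθ1
      · exact zero_le_one
  refine ⟨φ, hφm, h1, hintg ▸ hθ2, ?_⟩
  apply le_antisymm _ (Phi_ge μ hg hφm h1 (hintg ▸ hθ2))
  rw [Phi_layer, lint_phi_layer μ hg hφm]
  apply setLIntegral_mono' measurableSet_Ioi
  intro α hα
  by_cases hc : l ≤ ENNReal.ofReal α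
  · apply (min_le_right _ _).trans
    calc _ = ∫⁻ x in {x | ENNReal.ofReal α < G x}, 1 ∂μ := by simp [hGdef]
      _ ≤ _ := by
        apply setLIntegral_mono' (measurableSet_lt measurable_const hG)
        intro x hx
        have : l < G x := lt_of_le_of_lt hc hx
        simp [φ, this]
  · push Not at hc
    apply (min_le_left _ _).trans
    rw [← hθ3 (lt_of_le_of_lt zero_le hc), ← hintg]
    rw [← lintegral_indicator (measurableSet_lt measurable_const hG)]
    apply lintegral_mono
    intro x
    simp only [indicator_apply, mem_ofPred_eq]
    split_ifs with h
    · exact le_rfl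
    · push Not at h
      have h3 : G x < l := lt_of_le_of_lt h hc
      simp [φ, h3.not_gt, h3.ne]

lemma Phi_le_lint (μ : Measure X) [SFinite μ] {g : X → ℝ} (hg : Measurable g)
    (hfin : μ {x | g x ≠ 0} ≠ ∞) (t : ℝ) : Phi μ g t ≤ ∫⁻ x, ENNReal.ofReal |g x| ∂μ := by
  obtain ⟨φ, h1, h2, h3, h4⟩ := Phi_att μ hg hfin t
  rw [h4]
  apply lintegral_mono
  intro x
  calc _ ≤ 1 * ENNReal.ofReal |g x| := mul_le_mul' (h2 x) le_rfl
    _ = _ := one_mul _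

lemma setLint_le_Phi (μ : Measure X) [SFinite μ] {g : X → ℝ} (hg : Measurable g) {E : Set X}
    (hE : MeasurableSet E) {t : ℝ} (ht : μ E ≤ ENNReal.ofReal t) :
    ∫⁻ x in E, ENNReal.ofReal |g x| ∂μ ≤ Phi μ g t := by
  have := Phi_ge μ hg (φ := E.indicator 1) (measurable_one.indicator hE)
    (fun x => indicator_le_self' (by simp) x) (t := t) (by rwa [lintegral_indicator_one hE])
  refine le_trans (le_of_eq ?_) this
  rw [← lintegral_indicator hE]
  apply lintegral_congr
  intro x
  by_cases h : x ∈ E <;> simp [h]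

lemma rearr_mono (μ : Measure X) {f g : X → ℝ} (h : ∀ x, |f x| ≤ |g x|) (s : ℝ) :
    rearr μ f s ≤ rearr μ g s := by
  apply sInf_le_sInf
  intro α hα
  refine le_trans (measure_mono ?_) hα
  intro x hx
  exact lt_of_lt_of_le hx (ENNReal.ofReal_le_ofReal (h x))

lemma Phi_mono_fun (μ : Measure X) {f g : X → ℝ} (h : ∀ x, |f x| ≤ |g x|) (s : ℝ) :
    Phi μ f s ≤ Phi μ g s := lintegral_mono fun t => rearr_mono μ h t

end helpers

section seqs

lemma tsum_holder {ι : Type*} (f g : ι → ℝ≥0∞) {p q : ℝ} (h : p.HolderConjugate q) :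
    ∑' i, f i * g i ≤ (∑' i, f i ^ p) ^ (1 / p) * (∑' i, g i ^ q) ^ (1 / q) := by
  let _ : MeasurableSpace ι := ⊤
  have := ENNReal.lintegral_mul_le_Lp_mul_Lq (Measure.count (α := ι)) h (f := f) (g := g)
    (Measurable.of_discrete).aemeasurable (Measurable.of_discrete).aemeasurable
  simpa [lintegral_count] using this

/-- Mixed sequence modular. -/
noncomputable def mixN {U J : Type*} (q r : ℝ) (w : U → J → ℝ≥0∞) : ℝ≥0∞ :=
  ∑' u, (∑' j, w u j ^ r) ^ (q / r)

lemma mix_holder {U J : Type*} (w v : U → J → ℝ≥0∞) {q Q r R : ℝ} (hq : q.HolderConjugate Q)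
    (hr : r.HolderConjugate R) :
    ∑' u, ∑' j, w u j * v u j ≤ (mixN q r w) ^ (1 / q) * (mixN Q R v) ^ (1 / Q) := by
  calc ∑' u, ∑' j, w u j * v u j
      ≤ ∑' u, (∑' j, w u j ^ r) ^ (1 / r) * (∑' j, v u j ^ R) ^ (1 / R) :=
        ENNReal.tsum_le_tsum fun u => tsum_holder _ _ hr
    _ ≤ _ := by
        refine (tsum_holder _ _ hq).trans (le_of_eq ?_)
        simp only [mixN, ← ENNReal.rpow_mul]
        congr 4
        · ext u; congr 1; ring
        · ext u; congr 1; ring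

lemma mix_dual {U J : Type*} (w : U → J → ℝ≥0∞) {q Q r R : ℝ} (hq : q.HolderConjugate Q)
    (hr : r.HolderConjugate R) (hw : ∀ u j, w u j ≠ ∞) (C : ℝ≥0∞)
    (H : ∀ (S : Finset U) (T : Finset J) (y : U → J → ℝ≥0∞), (∀ u j, y u j ≠ ∞) →
      (∀ u j, ¬ (u ∈ S ∧ j ∈ T) → y u j = 0) →
      ∑' u, ∑' j, y u j * w u j ≤ C * (mixN Q R y) ^ (1 / Q)) :
    mixN q r w ≤ C ^ q := by
  classical
  have hr0 := hr.pos
  have hq0 := hq.pos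
  have hR0 := hr.symm.pos
  have hQ0 := hq.symm.pos
  have hr1 := hr.lt
  have fin : ∀ (S : Finset U) (T : Finset J), ∑ u ∈ S, (∑ j ∈ T, w u j ^ r) ^ (q / r) ≤ C ^ q := by
    intro S T
    set s : U → ℝ≥0∞ := fun u => ∑ j ∈ T, w u j ^ r with hs
    have hsf : ∀ u, s u ≠ ∞ := fun u =>
      (ENNReal.sum_lt_top.2 fun j _ => ENNReal.rpow_lt_top_of_nonneg hr0.le (hw u j)).ne
    let y : U → J → ℝ≥0∞ := fun u j =>
      if u ∈ S ∧ j ∈ T then s u ^ (q / r - 1) * w u j ^ (r - 1) else 0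
    have hs0 : ∀ u, s u = 0 → ∀ j ∈ T, w u j = 0 := by
      intro u hu j hj
      have := (Finset.sum_eq_zero_iff.1 hu) j hj
      simpa [ENNReal.rpow_eq_zero_iff, hr0, hr0.le.not_gt] using this
    have hyf : ∀ u j, y u j ≠ ∞ := by
      intro u j
      simp only [y]
      split_ifs with h
      · by_cases h0 : s u = 0
        · rw [hs0 u h0 j h.2, ENNReal.zero_rpow_of_pos (by linarith)]; simp
        · exact ENNReal.mul_ne_top (ENNReal.rpow_ne_top_of_ne_zero h0 (hsf u))
            (ENNReal.rpow_ne_top_of_nonneg (by linarith) (hw u j))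
      · simp
    have h1 := H S T y hyf (fun u j h => by simp only [y, if_neg h])
    have inner : ∀ u, ∑' j, y u j * w u j = if u ∈ S then s u ^ (q / r) else 0 := by
      intro u
      rw [tsum_eq_sum (s := T)]
      · by_cases hu : u ∈ S
        · have : ∀ j ∈ T, y u j * w u j = s u ^ (q / r - 1) * w u j ^ r := by
            intro j hj
            simp only [y, hu, hj, true_and, if_true]
            rw [mul_assoc]
            congr 1
            conv_lhs => rw [← ENNReal.rpow_one (w u j)]
            rw [← ENNReal.rpow_mul, ← ENNReal.rpow_add_of_nonneg _ _ (by linarith) (by linarith)]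
            congr 1; ring
          rw [Finset.sum_congr rfl this, ← Finset.mul_sum, if_pos hu]
          change _ * s u = _
          by_cases h0 : s u = 0
          · rw [h0, mul_zero, ENNReal.zero_rpow_of_pos (by positivity)]
          · nth_rewrite 2 [← ENNReal.rpow_one (s u)]
            rw [← ENNReal.rpow_add _ _ h0 (hsf u)]
            congr 1; ring
        · simp [y, hu]
      · intro j hj; simp [y, hj]
    have innerR : ∀ u, (∑' j, y u j ^ R) ^ (Q / R) = if u ∈ S then s u ^ (q / r) else 0 := by
      intro u
      rw [tsum_eq_sum (s := T)]
      · by_cases hu : u ∈ S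
        · have : ∀ j ∈ T, y u j ^ R = s u ^ ((q / r - 1) * R) * w u j ^ r := by
            intro j hj
            simp only [y, hu, hj, true_and, if_true]
            rw [ENNReal.mul_rpow_of_nonneg _ _ hR0.le, ← ENNReal.rpow_mul, ← ENNReal.rpow_mul]
            congr 2
            rw [hr.sub_one_mul_conj]
          rw [Finset.sum_congr rfl this, ← Finset.mul_sum, if_pos hu]
          change (_ * s u) ^ _ = _
          by_cases h0 : s u = 0
          · rw [h0, mul_zero, ENNReal.zero_rpow_of_pos (by positivity),
              ENNReal.zero_rpow_of_pos (by positivity)]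
          · nth_rewrite 2 [← ENNReal.rpow_one (s u)]
            rw [← ENNReal.rpow_add _ _ h0 (hsf u), ← ENNReal.rpow_mul]
            congr 1
            have e1 := hr.inv_add_inv_eq_one
            have e2 := hq.inv_add_inv_eq_one
            have e3 : ((q / r - 1) * R + 1) * (Q / R) = Q * (q / r - (1 - R⁻¹)) := by
              field_simp; ring
            rw [e3, ← e1, add_sub_cancel_right]
            have e4 : Q * (q / r - r⁻¹) = ((q - 1) * Q) / r := by field_simp
            rw [e4, hq.sub_one_mul_conj]
        · simp only [y, hu, false_and, if_false]
          rw [ENNReal.zero_rpow_of_pos hR0]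
          simp
          positivity
      · intro j hj; simp [y, hj, hR0]
    set t := ∑ u ∈ S, s u ^ (q / r) with ht
    have htf : t ≠ ∞ := (ENNReal.sum_lt_top.2 fun u _ =>
      ENNReal.rpow_lt_top_of_nonneg (by positivity) (hsf u)).ne
    have eT : ∑' u, (if u ∈ S then s u ^ (q / r) else 0) = t := by
      rw [tsum_eq_sum (s := S)]
      · exact Finset.sum_congr rfl fun u hu => by simp [hu]
      · intro u hu; simp [hu]
    rw [mixN] at h1
    simp only [inner, innerR, eT] at h1
    by_cases h0 : t = 0
    · rw [h0]; exact zero_le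
    have e2 := hq.inv_add_inv_eq_one
    have h2 : t ^ (1 / q) ≤ C := by
      have e : t = t ^ (1 / q) * t ^ (1 / Q) := by
        rw [← ENNReal.rpow_add _ _ h0 htf]
        simp [e2]
      have h1 : t ^ (1 / q) * t ^ (1 / Q) ≤ C * t ^ (1 / Q) := e ▸ h1
      exact (ENNReal.mul_le_mul_iff_left (by simp [h0, htf])
        (ENNReal.rpow_ne_top_of_nonneg (by positivity) htf)).1 h1
    calc t = (t ^ (1 / q)) ^ q := by rw [← ENNReal.rpow_mul]; field_simp; simp
      _ ≤ C ^ q := ENNReal.rpow_le_rpow h2 hq0.le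
  rw [mixN, ENNReal.tsum_eq_iSup_sum]
  refine iSup_le fun S => ?_
  have ht : Tendsto (fun T : Finset J => ∑ u ∈ S, (∑ j ∈ T, w u j ^ r) ^ (q / r)) atTop
      (𝓝 (∑ u ∈ S, (∑' j, w u j ^ r) ^ (q / r))) := by
    apply tendsto_finsetSum
    intro u _
    exact (ENNReal.continuous_rpow_const.tendsto _).comp (ENNReal.summable.hasSum)
  exact le_of_tendsto' ht fun T => fin S T

lemma young (y K : ℤ → ℝ≥0∞) {R R' : ℝ} (h : R.HolderConjugate R') :
    ∑' i, (∑' j, y j * K (i - j)) ^ R ≤ (∑' m, K m) ^ R * ∑' j, y j ^ R := by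
  have hR := h.pos
  have hR' := h.symm.pos
  have e1 := h.inv_add_inv_eq_one
  have s1 : ∀ i : ℤ, ∑' j, K (i - j) = ∑' m, K m := fun i => (Equiv.subLeft i).tsum_eq K
  have s2 : ∀ j : ℤ, ∑' i, K (i - j) = ∑' m, K m := fun j => (Equiv.subRight j).tsum_eq K
  have key : ∀ i, (∑' j, y j * K (i - j)) ^ R ≤
      (∑' j, y j ^ R * K (i - j)) * (∑' m, K m) ^ (R - 1) := by
    intro i
    have h1 : ∑' j, y j * K (i - j) = ∑' j, (y j * K (i - j) ^ (1 / R)) * K (i - j) ^ (1 / R') := by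
      congr 1; ext j
      rw [mul_assoc, ← ENNReal.rpow_add_of_nonneg _ _ (by positivity) (by positivity)]
      simp [e1]
    rw [h1]
    calc _ ≤ ((∑' j, (y j * K (i - j) ^ (1 / R)) ^ R) ^ (1 / R) *
            (∑' j, (K (i - j) ^ (1 / R')) ^ R') ^ (1 / R')) ^ R :=
          ENNReal.rpow_le_rpow (tsum_holder _ _ h) hR.le
      _ = _ := by
          rw [ENNReal.mul_rpow_of_nonneg _ _ hR.le, ← ENNReal.rpow_mul, ← ENNReal.rpow_mul]
          congr 1
          · rw [one_div_mul_cancel hR.ne', ENNReal.rpow_one]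
            congr 1; ext j
            rw [ENNReal.mul_rpow_of_nonneg _ _ hR.le, ← ENNReal.rpow_mul,
              one_div_mul_cancel hR.ne', ENNReal.rpow_one]
          · have : ∀ j, (K (i - j) ^ (1 / R')) ^ R' = K (i - j) := by
              intro j
              rw [← ENNReal.rpow_mul, one_div_mul_cancel hR'.ne', ENNReal.rpow_one]
            simp only [this, s1]
            congr 1
            have : 1 / R' = 1 - R⁻¹ := by rw [one_div]; linarith
            rw [this]; field_simp
  calc _ ≤ ∑' i, (∑' j, y j ^ R * K (i - j)) * (∑' m, K m) ^ (R - 1) := ENNReal.tsum_le_tsum key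
    _ = (∑' j, y j ^ R * (∑' m, K m)) * (∑' m, K m) ^ (R - 1) := by
        rw [ENNReal.tsum_mul_right, ENNReal.tsum_comm]
        congr 1
        congr 1; ext j
        rw [ENNReal.tsum_mul_left, s2]
    _ = _ := by
        rw [ENNReal.tsum_mul_right, mul_assoc]
        nth_rewrite 1 [← ENNReal.rpow_one (∑' m, K m)]
        rw [← ENNReal.rpow_add_of_nonneg _ _ (by norm_num) (by linarith [h.lt]), mul_comm]
        congr 2; ring

lemma tsum_dct {ι : Type*} [Countable ι] (F : ℕ → ι → ℝ≥0∞) (b : ι → ℝ≥0∞)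
    (hb : ∀ n i, F n i ≤ b i) (hs : ∑' i, b i ≠ ∞) (h0 : ∀ i, Tendsto (fun n => F n i) atTop (𝓝 0)) :
    Tendsto (fun n => ∑' i, F n i) atTop (𝓝 0) := by
  let _ : MeasurableSpace ι := ⊤
  have := tendsto_lintegral_of_dominated_convergence (μ := Measure.count (α := ι)) (F := F)
    (f := fun _ => 0) b (fun n => Measurable.of_discrete) (fun n => .of_forall (hb n))
    (by simpa [lintegral_count] using hs) (.of_forall h0)
  simpa [lintegral_count] using this

lemma mix_dct {U J : Type*} [Countable U] [Countable J] {q r : ℝ} (hq : 0 < q) (hr : 0 < r)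
    (w : ℕ → U → J → ℝ≥0∞)
    (b : U → J → ℝ≥0∞) (hb : ∀ n u j, w n u j ≤ b u j) (hs : mixN q r b ≠ ∞)
    (h0 : ∀ u j, Tendsto (fun n => w n u j) atTop (𝓝 0)) :
    Tendsto (fun n => mixN q r (w n)) atTop (𝓝 0) := by
  have hqr : 0 < q / r := by positivity
  have z : ∀ {c : ℝ} (_ : 0 < c) {f : ℕ → ℝ≥0∞}, Tendsto f atTop (𝓝 0) →
      Tendsto (fun n => f n ^ c) atTop (𝓝 0) := by
    intro c hc f hf
    have := (ENNReal.continuous_rpow_const (y := c)).tendsto 0 |>.comp hf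
    simpa [ENNReal.zero_rpow_of_pos hc, Function.comp_def] using this
  refine tsum_dct _ (fun u => (∑' j, b u j ^ r) ^ (q / r)) (fun n u => ?_) hs (fun u => ?_)
  · refine ENNReal.rpow_le_rpow (ENNReal.tsum_le_tsum fun j => ?_) hqr.le
    exact ENNReal.rpow_le_rpow (hb n u j) hr.le
  · apply z hqr
    refine tsum_dct _ (fun j => b u j ^ r) (fun n j => ?_) ?_ (fun j => z hr (h0 u j))
    · exact ENNReal.rpow_le_rpow (hb n u j) hr.le
    · intro h
      have := ENNReal.ne_top_of_tsum_ne_top hs u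
      simp only [h] at this
      exact this (ENNReal.top_rpow_of_pos hqr)

end seqs

section disc
variable {X : Type*} [MeasurableSpace X]

lemma ofReal_two_rpow (x : ℝ) : ENNReal.ofReal ((2:ℝ) ^ x) = (2:ℝ≥0∞) ^ x := by
  rw [← ENNReal.ofReal_rpow_of_pos (by norm_num)]; simp

lemma two_rpow_ne_zero (x : ℝ) : (2:ℝ≥0∞) ^ x ≠ 0 := by simp

lemma two_rpow_ne_top (x : ℝ) : (2:ℝ≥0∞) ^ x ≠ ∞ :=
  ENNReal.rpow_ne_top_of_ne_zero (by simp) (by simp)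

lemma two_rpow_add (x y : ℝ) : (2:ℝ≥0∞) ^ (x + y) = 2 ^ x * 2 ^ y :=
  ENNReal.rpow_add _ _ (by simp) (by simp)

noncomputable def Wd (μ : Measure X) (p : ℝ) (g : X → ℝ) (j : ℤ) : ℝ≥0∞ :=
  2 ^ ((j:ℝ) / p - j) * Phi μ g (2 ^ (j:ℝ))

lemma dyadic_split (F : ℝ → ℝ≥0∞) :
    ∫⁻ t in Ioi (0:ℝ), F t = ∑' j : ℤ, ∫⁻ t in Ioc ((2:ℝ) ^ (j:ℝ)) (2 ^ ((j:ℝ) + 1)), F t := by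
  have hU : Ioi (0:ℝ) = ⋃ j : ℤ, Ioc ((2:ℝ) ^ (j:ℝ)) (2 ^ ((j:ℝ) + 1)) := by
    ext x
    simp only [mem_Ioi, mem_iUnion]
    constructor
    · intro hx
      obtain ⟨n, hn⟩ := exists_mem_Ioc_zpow hx (y := 2) (by norm_num)
      refine ⟨n, ?_⟩
      have : (2:ℝ) ^ ((n:ℝ) + 1) = 2 ^ (n + 1) := by
        rw [← Real.rpow_intCast]; push_cast; rfl
      rw [this, Real.rpow_intCast]; exact hn
    · rintro ⟨j, hj, _⟩
      exact lt_trans (by positivity) hj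
  rw [hU, lintegral_iUnion (fun j => measurableSet_Ioc)]
  have hm : Monotone (fun j : ℤ => (2:ℝ) ^ (j:ℝ)) := by
    intro a b hab
    exact Real.rpow_le_rpow_of_exponent_le (by norm_num) (by exact_mod_cast hab)
  have := hm.pairwise_disjoint_on_Ioc_succ
  simpa using this

lemma vol_dyadic (j : ℤ) : volume (Ioc ((2:ℝ) ^ (j:ℝ)) (2 ^ ((j:ℝ) + 1))) = (2:ℝ≥0∞) ^ (j:ℝ) := by
  rw [Real.volume_Ioc, ← ofReal_two_rpow, Real.rpow_add (by norm_num)]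
  congr 1
  simp; ring

lemma lint_le (μ : Measure X) (g : X → ℝ) {p r : ℝ} (hp : 0 < p) (hr : 0 < r) :
    ∫⁻ t in Ioi (0:ℝ), (ENNReal.ofReal (t ^ p⁻¹) * rearrStar μ g t) ^ r / ENNReal.ofReal t ≤
      2 ^ r * ∑' j, Wd μ p g j ^ r := by
  rw [dyadic_split]
  have key : ∀ j : ℤ, ∫⁻ t in Ioc ((2:ℝ) ^ (j:ℝ)) (2 ^ ((j:ℝ) + 1)),
      (ENNReal.ofReal (t ^ p⁻¹) * rearrStar μ g t) ^ r / ENNReal.ofReal t ≤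
      (2 * Wd μ p g (j + 1)) ^ r := by
    intro j
    calc _ ≤ ∫⁻ t in Ioc ((2:ℝ) ^ (j:ℝ)) (2 ^ ((j:ℝ) + 1)),
          (2 * Wd μ p g (j + 1)) ^ r / (2:ℝ≥0∞) ^ (j:ℝ) := by
          apply setLIntegral_mono' measurableSet_Ioc
          intro t ht
          have h2j : (0:ℝ) < 2 ^ (j:ℝ) := by positivity
          have ht0 : 0 < t := h2j.trans ht.1
          have a1 : ENNReal.ofReal (t ^ p⁻¹) ≤ 2 ^ (((j:ℝ) + 1) / p) := by
            rw [← ofReal_two_rpow]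
            apply ENNReal.ofReal_le_ofReal
            rw [div_eq_mul_inv, Real.rpow_mul (by norm_num)]
            exact Real.rpow_le_rpow ht0.le ht.2 (by positivity)
          have a2 : (2:ℝ≥0∞) ^ (j:ℝ) ≤ ENNReal.ofReal t := by
            rw [← ofReal_two_rpow]
            exact ENNReal.ofReal_le_ofReal ht.1.le
          have a3 : Phi μ g t ≤ Phi μ g (2 ^ ((j:ℝ) + 1)) := Phi_mono μ g ht.2
          apply ENNReal.div_le_div _ a2
          apply ENNReal.rpow_le_rpow _ hr.le
          calc _ ≤ (2:ℝ≥0∞) ^ (((j:ℝ) + 1) / p) * (((2:ℝ≥0∞) ^ (j:ℝ))⁻¹ *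
                Phi μ g (2 ^ ((j:ℝ) + 1))) :=
                mul_le_mul' a1 (mul_le_mul' (ENNReal.inv_le_inv.2 a2) a3)
            _ = _ := by
                rw [Wd, ← ENNReal.rpow_neg, ← mul_assoc, ← mul_assoc, ← two_rpow_add]
                push_cast
                congr 1
                nth_rewrite 2 [← ENNReal.rpow_one 2]
                rw [← two_rpow_add]
                congr 1; ring
      _ = _ := by
          rw [lintegral_const, Measure.restrict_apply MeasurableSet.univ, univ_inter, vol_dyadic,
            ENNReal.div_mul_cancel (two_rpow_ne_zero _) (two_rpow_ne_top _)]
  calc _ ≤ ∑' j : ℤ, (2 * Wd μ p g (j + 1)) ^ r := ENNReal.tsum_le_tsum key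
    _ = ∑' j : ℤ, (2 * Wd μ p g j) ^ r :=
        (Equiv.addRight (1:ℤ)).tsum_eq (fun j => (2 * Wd μ p g j) ^ r)
    _ = _ := by
        rw [← ENNReal.tsum_mul_left]
        congr 1; ext j
        rw [ENNReal.mul_rpow_of_nonneg _ _ hr.le]

lemma lint_ge (μ : Measure X) (g : X → ℝ) {p r : ℝ} (hp : 0 < p) (hr : 0 < r) :
    ∑' j, Wd μ p g j ^ r ≤ 2 ^ (r + 1) * ∫⁻ t in Ioi (0:ℝ),
      (ENNReal.ofReal (t ^ p⁻¹) * rearrStar μ g t) ^ r / ENNReal.ofReal t := by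
  rw [dyadic_split]
  have key : ∀ j : ℤ, 2 ^ (-(r + 1)) * Wd μ p g j ^ r ≤
      ∫⁻ t in Ioc ((2:ℝ) ^ (j:ℝ)) (2 ^ ((j:ℝ) + 1)),
      (ENNReal.ofReal (t ^ p⁻¹) * rearrStar μ g t) ^ r / ENNReal.ofReal t := by
    intro j
    calc _ = ∫⁻ t in Ioc ((2:ℝ) ^ (j:ℝ)) (2 ^ ((j:ℝ) + 1)),
          (2 ^ (-1:ℝ) * Wd μ p g j) ^ r / (2:ℝ≥0∞) ^ ((j:ℝ) + 1) := by
          rw [lintegral_const, Measure.restrict_apply MeasurableSet.univ, univ_inter, vol_dyadic,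
            ENNReal.mul_rpow_of_nonneg _ _ hr.le, ← ENNReal.rpow_mul, div_eq_mul_inv,
            ← ENNReal.rpow_neg]
          rw [show (2:ℝ≥0∞) ^ (-1 * r) * Wd μ p g j ^ r * 2 ^ (-((j:ℝ) + 1)) * 2 ^ (j:ℝ) =
            (2 ^ (-1 * r) * 2 ^ (-((j:ℝ) + 1)) * 2 ^ (j:ℝ)) * Wd μ p g j ^ r by ring]
          rw [← two_rpow_add, ← two_rpow_add]
          congr 2; ring
      _ ≤ _ := by
          apply setLIntegral_mono' measurableSet_Ioc
          intro t ht
          have h2j : (0:ℝ) < 2 ^ (j:ℝ) := by positivity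
          have ht0 : 0 < t := h2j.trans ht.1
          have a1 : 2 ^ ((j:ℝ) / p) ≤ ENNReal.ofReal (t ^ p⁻¹) := by
            rw [← ofReal_two_rpow]
            apply ENNReal.ofReal_le_ofReal
            rw [div_eq_mul_inv, Real.rpow_mul (by norm_num)]
            exact Real.rpow_le_rpow h2j.le ht.1.le (by positivity)
          have a2 : ENNReal.ofReal t ≤ (2:ℝ≥0∞) ^ ((j:ℝ) + 1) := by
            rw [← ofReal_two_rpow]
            exact ENNReal.ofReal_le_ofReal ht.2
          have a3 : Phi μ g (2 ^ (j:ℝ)) ≤ Phi μ g t := Phi_mono μ g ht.1.le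
          apply ENNReal.div_le_div _ a2
          apply ENNReal.rpow_le_rpow _ hr.le
          calc _ = (2:ℝ≥0∞) ^ ((j:ℝ) / p) * (((2:ℝ≥0∞) ^ ((j:ℝ) + 1))⁻¹ *
                Phi μ g (2 ^ (j:ℝ))) := by
                rw [Wd, ← ENNReal.rpow_neg, ← mul_assoc, ← mul_assoc, ← two_rpow_add,
                  ← two_rpow_add]
                congr 2
                ring
            _ ≤ _ := mul_le_mul' a1 (mul_le_mul' (ENNReal.inv_le_inv.2 a2) a3)
  calc _ = 2 ^ (r + 1) * ∑' j : ℤ, 2 ^ (-(r + 1)) * Wd μ p g j ^ r := by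
        rw [ENNReal.tsum_mul_left, ← mul_assoc, ← two_rpow_add]; simp
    _ ≤ _ := by gcongr with j; exact key j

lemma lor_le (μ : Measure X) (g : X → ℝ) {p r : ℝ≥0∞} (hp : 0 < p.toReal) (hr : 1 < r.toReal) :
    lorentzNormStar μ p r g ≤ 4 * (∑' j, Wd μ p.toReal g j ^ r.toReal) ^ r.toReal⁻¹ := by
  have hrt : r ≠ ∞ := by rintro rfl; simp at hr; linarith
  have hr0 : 0 < r.toReal := by linarith
  rw [lorentzNormStar, lorentzNormOf, if_neg hrt]
  calc _ ≤ (2 ^ r.toReal * ∑' j, Wd μ p.toReal g j ^ r.toReal) ^ r.toReal⁻¹ :=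
        ENNReal.rpow_le_rpow (lint_le μ g hp hr0) (by positivity)
    _ = 2 * (∑' j, Wd μ p.toReal g j ^ r.toReal) ^ r.toReal⁻¹ := by
        rw [ENNReal.mul_rpow_of_nonneg _ _ (by positivity), ← ENNReal.rpow_mul,
          mul_inv_cancel₀ hr0.ne', ENNReal.rpow_one]
    _ ≤ _ := mul_le_mul' (by norm_num) le_rfl

lemma lor_ge (μ : Measure X) (g : X → ℝ) {p r : ℝ≥0∞} (hp : 0 < p.toReal) (hr : 1 < r.toReal) :
    (∑' j, Wd μ p.toReal g j ^ r.toReal) ^ r.toReal⁻¹ ≤ 4 * lorentzNormStar μ p r g := by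
  have hrt : r ≠ ∞ := by rintro rfl; simp at hr; linarith
  have hr0 : 0 < r.toReal := by linarith
  rw [lorentzNormStar, lorentzNormOf, if_neg hrt]
  refine (ENNReal.rpow_le_rpow (lint_ge μ g hp hr0) (by positivity)).trans ?_
  rw [ENNReal.mul_rpow_of_nonneg _ _ (by positivity), ← ENNReal.rpow_mul]
  refine mul_le_mul' ?_ le_rfl
  have : (4:ℝ≥0∞) = 2 ^ (2:ℝ) := by
    rw [show (2:ℝ) = (2:ℕ) by norm_num, ENNReal.rpow_natCast]; norm_num
  rw [this]
  apply ENNReal.rpow_le_rpow_of_exponent_le (by norm_num)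
  rw [add_mul, mul_inv_cancel₀ hr0.ne']
  have : r.toReal⁻¹ ≤ 1 := inv_le_one_of_one_le₀ hr.le
  linarith

abbrev UU := {u : ℤ // -1 ≤ u}

noncomputable def wt [Norm X] (μ : Measure X) (Ω : Set X) (a p : ℝ) (g : X → ℝ) (u : UU) (j : ℤ) :
    ℝ≥0∞ := 2 ^ ((u.1:ℝ) * a) * Wd μ p ((annulus Ω u.1).indicator g) j

lemma mixN_wt [Norm X] (μ : Measure X) (Ω : Set X) (a p : ℝ) (g : X → ℝ) {q r : ℝ} (hr : 0 < r) :
    mixN q r (wt μ Ω a p g) = ∑' u : UU, (2 ^ ((u.1:ℝ) * a) *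
      (∑' j, Wd μ p ((annulus Ω u.1).indicator g) j ^ r) ^ r⁻¹) ^ q := by
  rw [mixN]
  congr 1; ext u
  simp only [wt]
  have : ∀ j, ((2:ℝ≥0∞) ^ ((u.1:ℝ) * a) * Wd μ p ((annulus Ω u.1).indicator g) j) ^ r =
    (2 ^ ((u.1:ℝ) * a)) ^ r * Wd μ p ((annulus Ω u.1).indicator g) j ^ r := fun j =>
      ENNReal.mul_rpow_of_nonneg _ _ hr.le
  simp only [this]
  rw [ENNReal.tsum_mul_left, div_eq_inv_mul, ENNReal.rpow_mul,
    ENNReal.mul_rpow_of_nonneg _ _ (inv_nonneg.2 hr.le), ← ENNReal.rpow_mul _ r,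
    mul_inv_cancel₀ hr.ne', ENNReal.rpow_one]

lemma herz_le [Norm X] (μ : Measure X) (Ω : Set X) (a : ℝ) (g : X → ℝ) {p q r : ℝ≥0∞}
    (hp : 0 < p.toReal) (hq : 0 < q.toReal) (hr : 1 < r.toReal) :
    herzNormStar μ Ω a p q r g ≤
      4 * (mixN q.toReal r.toReal (wt μ Ω a p.toReal g)) ^ q.toReal⁻¹ := by
  have hqt : q ≠ ∞ := by rintro rfl; simp at hq
  rw [herzNormStar, herzNormWith, if_neg hqt, mixN_wt _ _ _ _ _ (by linarith)]
  calc _ ≤ (∑' u : UU, 4 ^ q.toReal * (2 ^ ((u.1:ℝ) * a) *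
      (∑' j, Wd μ p.toReal ((annulus Ω u.1).indicator g) j ^ r.toReal) ^ r.toReal⁻¹) ^ q.toReal) ^
        q.toReal⁻¹ := by
        apply ENNReal.rpow_le_rpow _ (by positivity)
        apply ENNReal.tsum_le_tsum
        intro u
        rw [ofReal_two_rpow, ← ENNReal.mul_rpow_of_nonneg _ _ hq.le]
        apply ENNReal.rpow_le_rpow _ hq.le
        refine (mul_le_mul' le_rfl (lor_le _ _ hp hr)).trans (le_of_eq (by ring))
    _ = _ := by
        rw [ENNReal.tsum_mul_left, ENNReal.mul_rpow_of_nonneg _ _ (by positivity),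
          ← ENNReal.rpow_mul, mul_inv_cancel₀ hq.ne', ENNReal.rpow_one]

lemma herz_ge [Norm X] (μ : Measure X) (Ω : Set X) (a : ℝ) (g : X → ℝ) {p q r : ℝ≥0∞}
    (hp : 0 < p.toReal) (hq : 0 < q.toReal) (hr : 1 < r.toReal) :
    (mixN q.toReal r.toReal (wt μ Ω a p.toReal g)) ^ q.toReal⁻¹ ≤
      4 * herzNormStar μ Ω a p q r g := by
  have hqt : q ≠ ∞ := by rintro rfl; simp at hq
  rw [herzNormStar, herzNormWith, if_neg hqt, mixN_wt _ _ _ _ _ (by linarith)]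
  calc _ ≤ (∑' u : UU, 4 ^ q.toReal * (ENNReal.ofReal (2 ^ ((u.1:ℝ) * a)) *
        lorentzNormStar μ p r ((annulus Ω u.1).indicator g)) ^ q.toReal) ^ q.toReal⁻¹ := by
        apply ENNReal.rpow_le_rpow _ (by positivity)
        apply ENNReal.tsum_le_tsum
        intro u
        rw [ofReal_two_rpow, ← ENNReal.mul_rpow_of_nonneg _ _ hq.le]
        apply ENNReal.rpow_le_rpow _ hq.le
        refine (mul_le_mul' le_rfl (lor_ge _ _ hp hr)).trans (le_of_eq (by ring))
    _ = _ := by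
        rw [ENNReal.tsum_mul_left, ENNReal.mul_rpow_of_nonneg _ _ (by positivity),
          ← ENNReal.rpow_mul, mul_inv_cancel₀ hq.ne', ENNReal.rpow_one]

end disc

section blocks
variable {X : Type*} [MeasurableSpace X]

lemma rearr_le_Phi (μ : Measure X) (g : X → ℝ) (j : ℤ) :
    rearr μ g (2 ^ (j:ℝ)) ≤ 2 ^ (-(j:ℝ)) * Phi μ g (2 ^ (j:ℝ)) := by
  have h : (2:ℝ≥0∞) ^ (j:ℝ) * rearr μ g (2 ^ (j:ℝ)) ≤ Phi μ g (2 ^ (j:ℝ)) := by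
    calc _ = ∫⁻ s in Ioc (0:ℝ) (2 ^ (j:ℝ)), rearr μ g (2 ^ (j:ℝ)) := by
          rw [lintegral_const, Measure.restrict_apply MeasurableSet.univ, univ_inter,
            Real.volume_Ioc, sub_zero, ofReal_two_rpow, mul_comm]
      _ ≤ _ := by
          apply setLIntegral_mono' measurableSet_Ioc
          intro s hs
          exact rearr_anti μ g hs.2
  calc _ = 2 ^ (-(j:ℝ)) * ((2:ℝ≥0∞) ^ (j:ℝ) * rearr μ g (2 ^ (j:ℝ))) := by
        rw [← mul_assoc, ← two_rpow_add]; simp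
    _ ≤ _ := mul_le_mul' le_rfl h

lemma exists_two_rpow_ge {M : ℝ≥0∞} (hM : M ≠ ∞) : ∃ m : ℤ, M ≤ ENNReal.ofReal (2 ^ (m:ℝ)) := by
  obtain ⟨n, hn⟩ := pow_unbounded_of_one_lt M.toReal (by norm_num : (1:ℝ) < 2)
  refine ⟨n, ?_⟩
  rw [← ENNReal.ofReal_toReal hM]
  apply ENNReal.ofReal_le_ofReal
  simpa using hn.le

lemma exists_two_rpow_lt {M : ℝ≥0∞} (hM : 0 < M) : ∃ m : ℤ, ENNReal.ofReal (2 ^ (m:ℝ)) < M := by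
  obtain ⟨m, hm⟩ := exists_two_rpow_ge (M := 2 * M⁻¹) (ENNReal.mul_ne_top (by simp) (by simp [hM.ne']))
  by_cases ht : M = ∞
  · exact ⟨0, by simp [ht]⟩
  refine ⟨-m, ?_⟩
  rw [ofReal_two_rpow] at hm ⊢
  push_cast
  rw [ENNReal.rpow_neg, ENNReal.inv_lt_iff_inv_lt]
  refine lt_of_lt_of_le ?_ hm
  rw [two_mul]
  exact ENNReal.lt_add_right (by simp [hM.ne']) (by simp [ht])

lemma block_holder (μ : Measure X) [SFinite μ] {f g : X → ℝ} (hf : Measurable f)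
    (hg : Measurable g) (hfin : μ {x | f x ≠ 0} ≠ ∞) {p P : ℝ} (hp : p.HolderConjugate P) :
    ∫⁻ x, ENNReal.ofReal |f x| * ENNReal.ofReal |g x| ∂μ ≤
      2 * ∑' j, Wd μ p f j * Wd μ P g j := by
  set l : ℤ → ℝ≥0∞ := fun j => rearr μ f (2 ^ (j:ℝ)) with hl
  set E : ℤ → Set X := fun j => {x | l j < ENNReal.ofReal |f x|} with hE
  have hG : Measurable fun x => ENNReal.ofReal |f x| := by fun_prop
  have hEm : ∀ j, MeasurableSet (E j) := fun j => measurableSet_lt measurable_const hG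
  have hEle : ∀ j, μ (E j) ≤ ENNReal.ofReal (2 ^ (j:ℝ)) := by
    intro j
    have := (lt_rearr μ f (2 ^ (j:ℝ)) (l j)).not
    simpa [hl, hE] using this
  have hmono : Monotone E := by
    intro i j hij x hx
    have hx : l i < ENNReal.ofReal |f x| := hx
    refine lt_of_le_of_lt (b := l i) ?_ hx
    apply rearr_anti
    exact Real.rpow_le_rpow_of_exponent_le (by norm_num) (by exact_mod_cast hij)
  obtain ⟨m, hm⟩ := exists_two_rpow_ge hfin
  have hlm : l m = 0 := by
    by_contra h
    have := (lt_rearr μ f (2 ^ (m:ℝ)) 0).1 (pos_iff_ne_zero.2 h)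
    apply absurd this
    push Not
    refine le_trans (measure_mono ?_) hm
    intro x hx
    simpa using hx
  have hcov : {x | f x ≠ 0} ⊆ (⋂ j, E j) ∪ ⋃ j : ℤ, (E (j + 1) \ E j) := by
    intro x hx
    by_contra hcon
    simp only [mem_union, mem_iInter, mem_iUnion, Set.mem_sdiff, not_or, not_forall, not_exists,
      not_and, not_not] at hcon
    obtain ⟨⟨k, hk⟩, h2⟩ := hcon
    have hxm : x ∈ E m := by
      simp only [hE, mem_ofPred_eq, hlm]; simpa using hx
    rcases le_total m k with h | h
    · exact hk (hmono h hxm)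
    · apply hk
      refine Int.leInductionDown (m := m) (motive := fun k _ => x ∈ E k) hxm ?_ k h
      intro n _ hn
      apply h2
      simpa using hn
  have hnull : μ (⋂ j, E j) = 0 := by
    by_contra h
    obtain ⟨k, hk⟩ := exists_two_rpow_lt (pos_iff_ne_zero.2 h)
    exact absurd ((measure_mono (iInter_subset _ k)).trans (hEle k)) (not_le.2 hk)
  have hsup : Function.support (fun x => ENNReal.ofReal |f x| * ENNReal.ofReal |g x|) ⊆
      (⋂ j, E j) ∪ ⋃ j : ℤ, (E (j + 1) \ E j) := by
    intro x hx
    apply hcov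
    intro h0
    simp [h0] at hx
  rw [← setLIntegral_eq_of_support_subset hsup]
  refine (lintegral_union_le _ _ _).trans ?_
  rw [setLIntegral_measure_zero _ _ hnull, zero_add]
  refine (lintegral_iUnion_le _ _).trans ?_
  have key : ∀ j : ℤ, ∫⁻ x in E (j + 1) \ E j, ENNReal.ofReal |f x| * ENNReal.ofReal |g x| ∂μ ≤
      2 * (Wd μ p f (j + 1) * Wd μ P g (j + 1)) := by
    intro j
    calc _ ≤ ∫⁻ x in E (j + 1) \ E j, l j * ENNReal.ofReal |g x| ∂μ := by
          apply setLIntegral_mono' ((hEm _).diff (hEm _))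
          intro x hx
          apply mul_le_mul' _ le_rfl
          have := hx.2
          simpa [hE] using this
      _ ≤ ∫⁻ x in E (j + 1), l j * ENNReal.ofReal |g x| ∂μ := lintegral_mono_set sdiff_subset
      _ = l j * ∫⁻ x in E (j + 1), ENNReal.ofReal |g x| ∂μ := by
          rw [lintegral_const_mul]; fun_prop
      _ ≤ (2 ^ (-(j:ℝ)) * Phi μ f (2 ^ ((j + 1 : ℤ):ℝ))) * Phi μ g (2 ^ ((j + 1 : ℤ):ℝ)) := by
          apply mul_le_mul'
          · refine (rearr_le_Phi μ f j).trans (mul_le_mul' le_rfl (Phi_mono μ f ?_))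
            apply Real.rpow_le_rpow_of_exponent_le (by norm_num)
            push_cast; linarith
          · exact setLint_le_Phi μ hg (hEm _) (hEle _)
      _ = _ := by
          simp only [Wd]
          rw [show ∀ a b c d : ℝ≥0∞, 2 * (a * b * (c * d)) = (2 * (a * c)) * b * d by
            intros; ring]
          congr 2
          rw [← two_rpow_add]
          nth_rewrite 2 [← ENNReal.rpow_one 2]
          rw [← two_rpow_add]
          congr 1
          have e := hp.inv_add_inv_eq_one
          push_cast
          have : ((j:ℝ) + 1) / p + (j + 1) / P = j + 1 := by
            rw [div_eq_mul_inv, div_eq_mul_inv, ← mul_add, e, mul_one]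
          linarith
  refine (ENNReal.tsum_le_tsum key).trans (le_of_eq ?_)
  rw [ENNReal.tsum_mul_left]
  congr 1
  exact (Equiv.addRight (1:ℤ)).tsum_eq (fun j => Wd μ p f j * Wd μ P g j)

noncomputable def Ker (P : ℝ) (m : ℤ) : ℝ≥0∞ := min (2 ^ ((m:ℝ) / P)) (2 ^ ((m:ℝ) / P - m))

lemma Ker_sum {P : ℝ} (hP : 1 < P) : ∑' m, Ker P m ≠ ∞ := by
  set c := min (1 / P) (1 - 1 / P) with hc
  have hc0 : 0 < c := by
    apply lt_min
    · positivity
    · rw [sub_pos, div_lt_one (by linarith)]; exact hP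
  have hx1 : (2:ℝ) ^ (-c) < 1 := Real.rpow_lt_one_of_one_lt_of_neg (by norm_num) (by linarith)
  have hx0 : 0 < (2:ℝ) ^ (-c) := by positivity
  have hs : Summable (fun m : ℤ => ((2:ℝ) ^ (-c)) ^ m.natAbs) := by
    apply Summable.of_nat_of_neg
    · simpa using summable_geometric_of_lt_one hx0.le hx1
    · simpa using summable_geometric_of_lt_one hx0.le hx1
  have hle : ∀ m, Ker P m ≤ ENNReal.ofReal (((2:ℝ) ^ (-c)) ^ m.natAbs) := by
    intro m
    have e : (((2:ℝ) ^ (-c)) ^ m.natAbs) = 2 ^ (-(c * m.natAbs)) := by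
      rw [← Real.rpow_natCast, ← Real.rpow_mul (by norm_num)]; ring_nf
    rw [e, ofReal_two_rpow, Ker]
    have hc1 : c ≤ 1 / P := min_le_left _ _
    have hc2 : c ≤ 1 - 1 / P := min_le_right _ _
    rcases le_total 0 m with h | h
    · refine (min_le_right _ _).trans (ENNReal.rpow_le_rpow_of_exponent_le (by norm_num) ?_)
      have e2 : ((m.natAbs : ℕ) : ℝ) = m := by
        rw [Nat.cast_natAbs, abs_of_nonneg h]
      have : (0:ℝ) ≤ m := by exact_mod_cast h
      rw [e2, div_eq_mul_one_div]
      nlinarith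
    · refine (min_le_left _ _).trans (ENNReal.rpow_le_rpow_of_exponent_le (by norm_num) ?_)
      have e2 : ((m.natAbs : ℕ) : ℝ) = -m := by
        rw [Nat.cast_natAbs, abs_of_nonpos h]; push_cast; rfl
      have : (m:ℝ) ≤ 0 := by exact_mod_cast h
      rw [e2, div_eq_mul_one_div]
      nlinarith
  apply ne_top_of_le_ne_top _ (ENNReal.tsum_le_tsum hle)
  exact hs.tsum_ofReal_ne_top

lemma block_upper (μ : Measure X) [SFinite μ] {h : X → ℝ} (hh : Measurable h)
    (hfin : μ {x | h x ≠ 0} ≠ ∞) {P : ℝ} (y : ℤ → ℝ≥0∞) (φ : ℤ → X → ℝ≥0∞)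
    (hφ : ∀ j, Measurable (φ j)) (h1 : ∀ j x, φ j x ≤ 1)
    (hi : ∀ j, ∫⁻ x, φ j x ∂μ ≤ ENNReal.ofReal (2 ^ (j:ℝ)))
    (hb : ∀ x, ENNReal.ofReal |h x| ≤ ∑' j : ℤ, (y j * 2 ^ (-(j:ℝ) / P)) * φ j x) (i : ℤ) :
    Wd μ P h i ≤ ∑' j, y j * Ker P (i - j) := by
  obtain ⟨θ, t1, t2, t3, t4⟩ := Phi_att μ hh hfin (2 ^ (i:ℝ))
  rw [ofReal_two_rpow] at t3
  simp only [ofReal_two_rpow] at hi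
  rw [Wd, t4]
  calc _ ≤ 2 ^ ((i:ℝ) / P - i) * ∫⁻ x, ∑' j : ℤ, (y j * 2 ^ (-(j:ℝ) / P)) * (θ x * φ j x) ∂μ := by
        refine mul_le_mul' le_rfl (lintegral_mono fun x => ?_)
        refine (mul_le_mul' le_rfl (hb x)).trans (le_of_eq ?_)
        rw [← ENNReal.tsum_mul_left]
        congr 1; ext j; ring
    _ = ∑' j : ℤ, 2 ^ ((i:ℝ) / P - i) * ((y j * 2 ^ (-(j:ℝ) / P)) * ∫⁻ x, θ x * φ j x ∂μ) := by
        have hm : ∀ j, Measurable fun x => θ x * φ j x := fun j => t1.mul (hφ j)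
        rw [lintegral_tsum (fun j => ((hm j).const_mul _).aemeasurable),
          ENNReal.tsum_mul_left]
        congr 2; ext j
        rw [lintegral_const_mul _ (hm j)]
    _ ≤ _ := by
        apply ENNReal.tsum_le_tsum
        intro j
        have b1 : ∫⁻ x, θ x * φ j x ∂μ ≤ 2 ^ (i:ℝ) :=
          (lintegral_mono fun x => (mul_le_mul' le_rfl (h1 j x)).trans (le_of_eq (mul_one _))).trans t3
        have b2 : ∫⁻ x, θ x * φ j x ∂μ ≤ 2 ^ (j:ℝ) :=
          (lintegral_mono fun x => (mul_le_mul' (t2 x) le_rfl).trans (le_of_eq (one_mul _))).trans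
            (hi j)
        rw [show 2 ^ ((i:ℝ) / P - i) * ((y j * 2 ^ (-(j:ℝ) / P)) * ∫⁻ x, θ x * φ j x ∂μ) =
          y j * (2 ^ ((i:ℝ) / P - i) * 2 ^ (-(j:ℝ) / P) * ∫⁻ x, θ x * φ j x ∂μ) by ring]
        refine mul_le_mul' le_rfl (le_min ?_ ?_)
        · refine (mul_le_mul' le_rfl b1).trans (le_of_eq ?_)
          rw [← two_rpow_add, ← two_rpow_add]
          congr 1; push_cast; ring
        · refine (mul_le_mul' le_rfl b2).trans (le_of_eq ?_)
          rw [← two_rpow_add, ← two_rpow_add]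
          congr 1; push_cast; ring

lemma Wd_le_mul (μ : Measure X) [SFinite μ] {h g : X → ℝ} (hh : Measurable h) (hg : Measurable g)
    (hfin : μ {x | h x ≠ 0} ≠ ∞) {c : ℝ≥0∞}
    (hb : ∀ x, ENNReal.ofReal |h x| ≤ c * ENNReal.ofReal |g x|) (P : ℝ) (i : ℤ) :
    Wd μ P h i ≤ c * Wd μ P g i := by
  obtain ⟨θ, t1, t2, t3, t4⟩ := Phi_att μ hh hfin (2 ^ (i:ℝ))
  rw [Wd, Wd, mul_left_comm]
  refine mul_le_mul' le_rfl ?_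
  rw [t4]
  calc _ ≤ ∫⁻ x, c * (θ x * ENNReal.ofReal |g x|) ∂μ := by
        apply lintegral_mono
        intro x
        exact (mul_le_mul' le_rfl (hb x)).trans (le_of_eq (by ring))
    _ = c * ∫⁻ x, θ x * ENNReal.ofReal |g x| ∂μ := by
        rw [lintegral_const_mul]; fun_prop
    _ ≤ _ := mul_le_mul' le_rfl (Phi_ge μ hg t1 t2 t3)

end blocks

section global
variable {X : Type*} [MeasurableSpace X] [Norm X]

structure Good (μ : Measure X) (Ω : Set X) : Prop where
  meas : ∀ u : UU, MeasurableSet (annulus Ω u.1)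
  fin : ∀ u : UU, μ (annulus Ω u.1) ≠ ∞
  disj : Pairwise fun u v : UU => Disjoint (annulus Ω u.1) (annulus Ω v.1)
  cov : ⋃ u : UU, annulus Ω u.1 = Ω

variable {μ : Measure X} [SFinite μ] {Ω : Set X}

lemma Good.sub (H : Good μ Ω) (u : UU) : annulus Ω u.1 ⊆ Ω := by
  intro x hx
  rw [← H.cov]
  exact mem_iUnion.2 ⟨u, hx⟩

lemma Good.suppfin (H : Good μ Ω) (u : UU) (g : X → ℝ) :
    μ {x | (annulus Ω u.1).indicator g x ≠ 0} ≠ ∞ := by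
  apply measure_ne_top_of_subset _ (H.fin u)
  intro x hx
  exact mem_of_indicator_ne_zero hx

lemma ofReal_abs_indicator (A : Set X) (g : X → ℝ) (x : X) :
    ENNReal.ofReal |A.indicator g x| = A.indicator (fun x => ENNReal.ofReal |g x|) x := by
  by_cases h : x ∈ A <;> simp [h]

lemma wt_le_mul (H : Good μ Ω) {h g : X → ℝ} (hh : Measurable h) (hg : Measurable g) {c : ℝ≥0∞}
    (hb : ∀ x ∈ Ω, ENNReal.ofReal |h x| ≤ c * ENNReal.ofReal |g x|) (a P : ℝ) (u : UU) (j : ℤ) :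
    wt μ Ω a P h u j ≤ c * wt μ Ω a P g u j := by
  rw [wt, wt, mul_left_comm]
  refine mul_le_mul' le_rfl ?_
  refine Wd_le_mul μ (hh.indicator (H.meas u)) (hg.indicator (H.meas u)) (H.suppfin u h) ?_ P j
  intro x
  by_cases hx : x ∈ annulus Ω u.1
  · simpa [hx] using hb x (H.sub u hx)
  · simp [hx]

lemma mixN_mul_le {U J : Type*} {q r : ℝ} (hq : 0 < q) (hr : 0 < r) {w v : U → J → ℝ≥0∞}
    {c : ℝ≥0∞} (h : ∀ u j, w u j ≤ c * v u j) : mixN q r w ≤ c ^ q * mixN q r v := by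
  rw [mixN, mixN, ← ENNReal.tsum_mul_left]
  apply ENNReal.tsum_le_tsum
  intro u
  calc _ ≤ (∑' j, c ^ r * v u j ^ r) ^ (q / r) := by
        apply ENNReal.rpow_le_rpow _ (by positivity)
        apply ENNReal.tsum_le_tsum
        intro j
        rw [← ENNReal.mul_rpow_of_nonneg _ _ hr.le]
        exact ENNReal.rpow_le_rpow (h u j) hr.le
    _ = _ := by
        rw [ENNReal.tsum_mul_left, ENNReal.mul_rpow_of_nonneg _ _ (by positivity),
          ← ENNReal.rpow_mul]
        congr 2; field_simp

lemma mix_ne_top_of_le (H : Good μ Ω) {h g : X → ℝ} (hh : Measurable h) (hg : Measurable g)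
    {a P Q R : ℝ} (hQ : 0 < Q) (hR : 0 < R) (hG : mixN Q R (wt μ Ω a P g) ≠ ∞) (c : ℝ)
    (hb : ∀ x ∈ Ω, |h x| ≤ c * |g x|) :
    mixN Q R (wt μ Ω a P h) ≠ ∞ := by
  have := mixN_mul_le hQ hR (wt_le_mul H hh hg (c := ENNReal.ofReal |c|) (fun x hx => by
    rw [← ENNReal.ofReal_mul (abs_nonneg _)]
    apply ENNReal.ofReal_le_ofReal
    exact (hb x hx).trans (mul_le_mul_of_nonneg_right (le_abs_self c) (abs_nonneg _))) a P)
  exact ne_top_of_le_ne_top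
    (ENNReal.mul_ne_top (ENNReal.rpow_ne_top_of_nonneg hQ.le ENNReal.ofReal_ne_top) hG) this

lemma wt_le_lint (H : Good μ Ω) {h : X → ℝ} (hh : Measurable h) (a P : ℝ) (u : UU) (j : ℤ) :
    wt μ Ω a P h u j ≤ (2 ^ ((u.1:ℝ) * a) * 2 ^ ((j:ℝ) / P - j)) *
      ∫⁻ x in annulus Ω u.1, ENNReal.ofReal |h x| ∂μ := by
  rw [wt, Wd, mul_assoc]
  refine mul_le_mul' le_rfl (mul_le_mul' le_rfl ?_)
  refine (Phi_le_lint μ (hh.indicator (H.meas u)) (H.suppfin u h) _).trans (le_of_eq ?_)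
  simp only [ofReal_abs_indicator]
  rw [lintegral_indicator (H.meas u)]

lemma wt_ne_top {U J : Type*} {q r : ℝ} (hq : 0 < q) (hr : 0 < r) {w : U → J → ℝ≥0∞}
    (h : mixN q r w ≠ ∞) (u : U) (j : J) : w u j ≠ ∞ := by
  intro ht
  have h1 := ENNReal.ne_top_of_tsum_ne_top h u
  have h2 : (∑' j, w u j ^ r) ≠ ∞ := by
    intro h; rw [h] at h1; exact h1 (ENNReal.top_rpow_of_pos (by positivity))
  have h3 := ENNReal.ne_top_of_tsum_ne_top h2 j
  rw [ht] at h3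
  exact h3 (ENNReal.top_rpow_of_pos hr)

lemma int_of_mix (H : Good μ Ω) {g : X → ℝ} (hg : Measurable g)
    {a P Q R : ℝ} (hQ : 0 < Q) (hR : 0 < R) (hG : mixN Q R (wt μ Ω a P g) ≠ ∞) (u : UU) :
    ∫⁻ x in annulus Ω u.1, ENNReal.ofReal |g x| ∂μ ≠ ∞ := by
  obtain ⟨m, hm⟩ := exists_two_rpow_ge (H.fin u)
  have h1 := setLint_le_Phi μ (hg.indicator (H.meas u)) (H.meas u) hm
  have h2 := wt_ne_top hQ hR hG u m
  rw [wt, Wd] at h2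
  have h3 : Phi μ ((annulus Ω u.1).indicator g) (2 ^ (m:ℝ)) ≠ ∞ := by
    intro h
    rw [h, ENNReal.mul_top (two_rpow_ne_zero _), ENNReal.mul_top (two_rpow_ne_zero _)] at h2
    exact h2 rfl
  refine ne_top_of_le_ne_top h3 (le_trans (le_of_eq ?_) h1)
  apply setLIntegral_congr_fun (H.meas u)
  intro x hx
  simp [hx]

lemma mix_tendsto (H : Good μ Ω) {g : X → ℝ} (hg : Measurable g) {h : ℕ → X → ℝ}
    (hh : ∀ n, Measurable (h n))
    {a P Q R : ℝ} (hQ : 0 < Q) (hR : 0 < R) (hG : mixN Q R (wt μ Ω a P g) ≠ ∞)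
    (hb : ∀ n, ∀ x ∈ Ω, |h n x| ≤ |g x|)
    (h0 : ∀ x ∈ Ω, Tendsto (fun n => h n x) atTop (𝓝 0)) :
    Tendsto (fun n => mixN Q R (wt μ Ω a P (h n))) atTop (𝓝 0) := by
  refine mix_dct hQ hR _ _ (fun n u j => ?_) hG (fun u j => ?_)
  · have := wt_le_mul H (hh n) hg (c := 1) (fun x hx => by
      rw [one_mul]; exact ENNReal.ofReal_le_ofReal (hb n x hx)) a P u j
    rwa [one_mul] at this
  · have hintg : Tendsto (fun n => ∫⁻ x in annulus Ω u.1, ENNReal.ofReal |h n x| ∂μ) atTop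
        (𝓝 (∫⁻ x in annulus Ω u.1, 0 ∂μ)) := by
      refine tendsto_lintegral_of_dominated_convergence (fun x => ENNReal.ofReal |g x|)
        (fun n => by have := hh n; fun_prop) (fun n => ?_) (int_of_mix H hg hQ hR hG u) ?_
      · refine (ae_restrict_iff' (H.meas u)).2 (.of_forall fun x hx => ?_)
        exact ENNReal.ofReal_le_ofReal (hb n x (H.sub u hx))
      · refine (ae_restrict_iff' (H.meas u)).2 (.of_forall fun x hx => ?_)
        have := ((h0 x (H.sub u hx)).abs)
        have := (ENNReal.continuous_ofReal.tendsto _).comp this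
        simpa [Function.comp_def] using this
    rw [lintegral_zero] at hintg
    have h2 := ENNReal.Tendsto.const_mul hintg
      (Or.inr (ENNReal.mul_ne_top (two_rpow_ne_top ((u.1:ℝ) * a)) (two_rpow_ne_top ((j:ℝ) / P - j))))
    rw [mul_zero] at h2
    exact tendsto_of_tendsto_of_tendsto_of_le_of_le tendsto_const_nhds h2 (fun n => zero_le)
      (fun n => wt_le_lint H (hh n) a P u j)

lemma mix_zero_ae (H : Good μ Ω) {h : X → ℝ} (hh : Measurable h)
    {a P Q R : ℝ} (hQ : 0 < Q) (hR : 0 < R) (h0 : ∀ᵐ x ∂(μ.restrict Ω), h x = 0) :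
    mixN Q R (wt μ Ω a P h) = 0 := by
  have key : ∀ u j, wt μ Ω a P h u j = 0 := by
    intro u j
    apply le_antisymm _ zero_le
    refine (wt_le_lint H hh a P u j).trans (le_of_eq ?_)
    rw [(lintegral_eq_zero_iff (by fun_prop)).2, mul_zero]
    have := ae_mono (Measure.restrict_mono_set μ (H.sub u)) h0
    filter_upwards [this] with x hx
    simp [hx]
  rw [mixN]
  simp [key, hR, hQ]

lemma global_holder (H : Good μ Ω) {f g : X → ℝ} (hf : Measurable f) (hg : Measurable g)
    {p P a : ℝ} (hp : p.HolderConjugate P) :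
    ∫⁻ x in Ω, ENNReal.ofReal |f x| * ENNReal.ofReal |g x| ∂μ ≤
      2 * ∑' u, ∑' j, wt μ Ω a p f u j * wt μ Ω (-a) P g u j := by
  rw [← ENNReal.tsum_mul_left]
  nth_rewrite 1 [← H.cov]
  refine (lintegral_iUnion_le _ _).trans (ENNReal.tsum_le_tsum fun u => ?_)
  have := block_holder μ (hf.indicator (H.meas u)) (hg.indicator (H.meas u)) (H.suppfin u f) hp
  calc _ = ∫⁻ x, ENNReal.ofReal |(annulus Ω u.1).indicator f x| *
        ENNReal.ofReal |(annulus Ω u.1).indicator g x| ∂μ := by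
        rw [← lintegral_indicator (H.meas u)]
        apply lintegral_congr
        intro x
        by_cases hx : x ∈ annulus Ω u.1 <;> simp [hx]
    _ ≤ _ := this
    _ = _ := by
        congr 2; ext j
        simp only [wt]
        rw [show ∀ x y z w : ℝ≥0∞, x * y * (z * w) = (x * z) * (y * w) by intros; ring,
          ← two_rpow_add]
        simp

lemma exists_rho (H : Good μ Ω) {a P Q R R' : ℝ} (hP : 1 < P) (hQ : 0 < Q)
    (hR : R.HolderConjugate R') :
    ∃ (ρ : X → ℝ) (c : UU → ℝ), Measurable ρ ∧ (∀ u, 0 < c u) ∧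
      (∀ u, ∀ x ∈ annulus Ω u.1, ρ x = c u) ∧ mixN Q R (wt μ Ω a P ρ) ≠ ∞ := by
  have hR0 := hR.pos
  -- finite block norms of the indicator functions
  let L : UU → ℝ≥0∞ := fun u => 2 ^ ((u.1:ℝ) * a) *
      (∑' j, Wd μ P ((annulus Ω u.1).indicator (fun _ => (1:ℝ))) j ^ R) ^ R⁻¹
  have hL : ∀ u, L u ≠ ∞ := by
    intro u
    refine ENNReal.mul_ne_top (two_rpow_ne_top _) (ENNReal.rpow_ne_top_of_nonneg (by positivity) ?_)
    obtain ⟨m, hm⟩ := exists_two_rpow_ge (H.fin u)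
    let y : ℤ → ℝ≥0∞ := fun j => if j = m then 2 ^ ((m:ℝ) / P) else 0
    let φ : ℤ → X → ℝ≥0∞ := fun j => if j = m then (annulus Ω u.1).indicator 1 else 0
    have hb := block_upper μ (P := P)
      ((measurable_const (a := (1:ℝ))).indicator (H.meas u)) (H.suppfin u _)
      y φ (fun j => by
        simp only [φ]; split_ifs
        · exact measurable_one.indicator (H.meas u)
        · exact measurable_zero) (fun j x => by
        simp only [φ]; split_ifs
        · exact indicator_le_self' (by simp) x
        · simp) (fun j => by
        simp only [φ]; split_ifs with h
        · rw [lintegral_indicator_one (H.meas u), h]; exact hm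
        · simp) (fun x => by
        refine le_trans (le_of_eq ?_) (ENNReal.le_tsum m)
        simp only [y, φ, if_true]
        rw [← two_rpow_add]
        by_cases hx : x ∈ annulus Ω u.1 <;> simp [hx, neg_div])
    have h2 := young y (Ker P) hR
    refine ne_top_of_le_ne_top ?_ (le_trans (ENNReal.tsum_le_tsum fun i =>
      ENNReal.rpow_le_rpow (hb i) hR0.le) h2)
    apply ENNReal.mul_ne_top (ENNReal.rpow_ne_top_of_nonneg hR0.le (Ker_sum hP))
    rw [tsum_eq_single m]
    · simp only [y, if_true]
      exact ENNReal.rpow_ne_top_of_nonneg hR0.le (two_rpow_ne_top _)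
    · intro j hj; simp [y, hj, hR0]
  obtain ⟨ε, hε, hεs⟩ := ENNReal.exists_pos_sum_of_countable' (ε := 1) one_ne_zero UU
  have hε1 : ∀ u, ε u ≠ ∞ := fun u => ENNReal.ne_top_of_tsum_ne_top hεs.ne_top u
  let c : UU → ℝ≥0∞ := fun u => ε u ^ Q⁻¹ / (1 + L u)
  have hc0 : ∀ u, c u ≠ 0 := by
    intro u
    refine ENNReal.div_ne_zero.2 ⟨?_, by simp [hL u]⟩
    rw [ne_eq, ENNReal.rpow_eq_zero_iff]
    rintro (h | h)
    · exact (hε u).ne' h.1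
    · exact hε1 u h.1
  have hc1 : ∀ u, c u ≠ ∞ := fun u =>
    ENNReal.div_ne_top (ENNReal.rpow_ne_top_of_nonneg (by positivity) (hε1 u)) (by simp)
  let ρ : X → ℝ := fun x => (∑' u : UU, (annulus Ω u.1).indicator (fun _ => c u) x).toReal
  have hρm : Measurable ρ := by
    apply Measurable.ennreal_toReal
    exact Measurable.ennreal_tsum fun u => measurable_const.indicator (H.meas u)
  have hρ : ∀ u, ∀ x ∈ annulus Ω u.1, ρ x = (c u).toReal := by
    intro u x hx
    simp only [ρ]
    rw [tsum_eq_single u]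
    · simp [hx]
    · intro v hv
      have := Set.disjoint_left.1 (H.disj hv.symm) hx
      simp [this]
  refine ⟨ρ, fun u => (c u).toReal, hρm, fun u => ENNReal.toReal_pos (hc0 u) (hc1 u), hρ, ?_⟩
  rw [mixN_wt _ _ _ _ _ hR0]
  refine ne_top_of_le_ne_top hεs.ne_top (ENNReal.tsum_le_tsum fun u => ?_)
  have hW : ∀ j, Wd μ P ((annulus Ω u.1).indicator ρ) j ≤
      c u * Wd μ P ((annulus Ω u.1).indicator (fun _ => (1:ℝ))) j := by
    intro j
    refine Wd_le_mul μ (hρm.indicator (H.meas u)) (measurable_const.indicator (H.meas u))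
      (H.suppfin u _) ?_ P j
    intro x
    by_cases hx : x ∈ annulus Ω u.1
    · simp [hx, hρ u x hx, hc1 u]
    · simp [hx]
  calc _ ≤ (c u * L u) ^ Q := by
        apply ENNReal.rpow_le_rpow _ hQ.le
        simp only [L]
        rw [mul_left_comm]
        refine mul_le_mul' le_rfl ?_
        calc _ ≤ (∑' j, c u ^ R *
              Wd μ P ((annulus Ω u.1).indicator (fun _ => (1:ℝ))) j ^ R) ^ R⁻¹ := by
              apply ENNReal.rpow_le_rpow _ (by positivity)
              apply ENNReal.tsum_le_tsum
              intro j
              rw [← ENNReal.mul_rpow_of_nonneg _ _ hR0.le]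
              exact ENNReal.rpow_le_rpow (hW j) hR0.le
          _ = _ := by
              rw [ENNReal.tsum_mul_left, ENNReal.mul_rpow_of_nonneg _ _ (by positivity),
                ← ENNReal.rpow_mul, mul_inv_cancel₀ hR0.ne', ENNReal.rpow_one]
    _ ≤ (ε u ^ Q⁻¹) ^ Q := by
        apply ENNReal.rpow_le_rpow _ hQ.le
        calc c u * L u ≤ c u * (1 + L u) := mul_le_mul' le_rfl le_add_self
          _ = _ := ENNReal.div_mul_cancel (by simp) (by simp [hL u])
    _ = ε u := by rw [← ENNReal.rpow_mul, inv_mul_cancel₀ hQ.ne', ENNReal.rpow_one]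

end global

section functional
variable {X : Type*} [MeasurableSpace X] [Norm X]

/-- A bounded linear functional on the space determined by the mixed norm of the weights. -/
structure Fnl (μ : Measure X) (Ω : Set X) (a P Q R : ℝ) (ψ : (X → ℝ) → ℝ) (C : ℝ≥0∞) : Prop where
  add : ∀ g h : X → ℝ, Measurable g → mixN Q R (wt μ Ω a P g) ≠ ∞ → Measurable h →
    mixN Q R (wt μ Ω a P h) ≠ ∞ → ψ (g + h) = ψ g + ψ h
  smul : ∀ (c : ℝ) (g : X → ℝ), Measurable g → mixN Q R (wt μ Ω a P g) ≠ ∞ → ψ (c • g) = c * ψ g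
  bd : ∀ g : X → ℝ, Measurable g → mixN Q R (wt μ Ω a P g) ≠ ∞ →
    ENNReal.ofReal |ψ g| ≤ C * mixN Q R (wt μ Ω a P g) ^ (1 / Q)

variable {μ : Measure X} [SFinite μ] {Ω : Set X} {a P Q R : ℝ} {ψ : (X → ℝ) → ℝ} {C : ℝ≥0∞}

lemma Fnl.zero_ae (F : Fnl μ Ω a P Q R ψ C) (H : Good μ Ω) (hQ : 0 < Q) (hR : 0 < R)
    {h : X → ℝ} (hh : Measurable h) (h0 : ∀ᵐ x ∂(μ.restrict Ω), h x = 0) : ψ h = 0 := by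
  have hz := mix_zero_ae (a := a) (P := P) H hh hQ hR h0
  have := F.bd h hh (by rw [hz]; simp)
  rw [hz, ENNReal.zero_rpow_of_pos (by positivity), mul_zero] at this
  have := ENNReal.ofReal_eq_zero.1 (le_antisymm this zero_le)
  exact abs_eq_zero.1 (le_antisymm this (abs_nonneg _))

lemma Fnl.tend (F : Fnl μ Ω a P Q R ψ C) (hC : C ≠ ∞) (H : Good μ Ω) (hQ : 0 < Q) (hR : 0 < R)
    {g : X → ℝ} (hg : Measurable g) {h : ℕ → X → ℝ} (hh : ∀ n, Measurable (h n))
    (hG : mixN Q R (wt μ Ω a P g) ≠ ∞) (hb : ∀ n, ∀ x ∈ Ω, |h n x| ≤ |g x|)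
    (h0 : ∀ x ∈ Ω, Tendsto (fun n => h n x) atTop (𝓝 0)) :
    Tendsto (fun n => ψ (h n)) atTop (𝓝 0) := by
  have h1 := mix_tendsto (a := a) (P := P) H hg hh hQ hR hG hb h0
  have h2 : Tendsto (fun n => C * mixN Q R (wt μ Ω a P (h n)) ^ (1 / Q)) atTop (𝓝 0) := by
    have h3 := (ENNReal.continuous_rpow_const (y := 1 / Q)).tendsto 0 |>.comp h1
    rw [ENNReal.zero_rpow_of_pos (by positivity)] at h3
    have := ENNReal.Tendsto.const_mul (a := C) h3 (Or.inr hC)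
    simpa using this
  have h4 : Tendsto (fun n => ENNReal.ofReal |ψ (h n)|) atTop (𝓝 0) :=
    tendsto_of_tendsto_of_tendsto_of_le_of_le tendsto_const_nhds h2 (fun _ => zero_le)
      (fun n => F.bd _ (hh n) (mix_ne_top_of_le H (hh n) hg hQ hR hG 1 (by simpa using hb n)))
  have h5 := (ENNReal.tendsto_toReal (a := 0) (by simp)).comp h4
  rw [tendsto_zero_iff_abs_tendsto_zero]
  simpa [Function.comp_def, ENNReal.toReal_ofReal (abs_nonneg _)] using h5

lemma Fnl.sub (F : Fnl μ Ω a P Q R ψ C) (H : Good μ Ω) (hQ : 0 < Q) (hR : 0 < R) {g h : X → ℝ}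
    (hg : Measurable g) (hg' : mixN Q R (wt μ Ω a P g) ≠ ∞) (hh : Measurable h)
    (hh' : mixN Q R (wt μ Ω a P h) ≠ ∞) : ψ (g - h) = ψ g - ψ h := by
  have h1 : mixN Q R (wt μ Ω a P ((-1 : ℝ) • h)) ≠ ∞ :=
    mix_ne_top_of_le H (hh.const_smul _) hh hQ hR hh' 1 (by intro x _; simp)
  have := F.add g ((-1 : ℝ) • h) hg hg' (hh.const_smul _) h1
  rw [F.smul _ _ hh hh'] at this
  rw [sub_eq_add_neg, ← neg_one_smul ℝ h, this]
  ring

/-- `ρ` times a function. -/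
lemma rho_ind_ne_top (H : Good μ Ω) (hQ : 0 < Q) (hR : 0 < R) {ρ : X → ℝ} (hρ : Measurable ρ)
    (hG : mixN Q R (wt μ Ω a P ρ) ≠ ∞) {E : Set X} (hE : MeasurableSet E) :
    mixN Q R (wt μ Ω a P (E.indicator ρ)) ≠ ∞ := by
  refine mix_ne_top_of_le H (hρ.indicator hE) hρ hQ hR hG 1 ?_
  intro x _
  by_cases h : x ∈ E <;> simp [h]

lemma Fnl.ind_finset (F : Fnl μ Ω a P Q R ψ C) (H : Good μ Ω) (hQ : 0 < Q) (hR : 0 < R)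
    {ρ : X → ℝ} (hρ : Measurable ρ) (hG : mixN Q R (wt μ Ω a P ρ) ≠ ∞) {E : ℕ → Set X}
    (hE : ∀ i, MeasurableSet (E i)) (hd : Pairwise (Function.onFun Disjoint E)) (s : Finset ℕ) :
    ψ ((⋃ i ∈ s, E i).indicator ρ) = ∑ i ∈ s, ψ ((E i).indicator ρ) := by
  classical
  induction s using Finset.induction_on with
  | empty =>
    simp only [Finset.notMem_empty, iUnion_of_empty, iUnion_empty, indicator_empty,
      Finset.sum_empty]
    exact F.zero_ae H hQ hR measurable_const (by simp)
  | insert i s hi ih =>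
    rw [Finset.sum_insert hi, ← ih, Finset.set_biUnion_insert,
      Set.indicator_union_of_disjoint]
    · have hm : MeasurableSet (⋃ x ∈ s, E x) := s.measurableSet_biUnion fun i _ => hE i
      exact F.add _ _ (hρ.indicator (hE i)) (rho_ind_ne_top H hQ hR hρ hG (hE i))
        (hρ.indicator hm) (rho_ind_ne_top H hQ hR hρ hG hm)
    · rw [Set.disjoint_iUnion₂_right]
      intro j hj
      exact hd (by rintro rfl; exact hi hj)

lemma Fnl.hasSum (F : Fnl μ Ω a P Q R ψ C) (hC : C ≠ ∞) (H : Good μ Ω) (hQ : 0 < Q) (hR : 0 < R)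
    {ρ : X → ℝ} (hρ : Measurable ρ) (hG : mixN Q R (wt μ Ω a P ρ) ≠ ∞) {E : ℕ → Set X}
    (hE : ∀ i, MeasurableSet (E i)) (hd : Pairwise (Function.onFun Disjoint E)) :
    HasSum (fun i => ψ ((E i).indicator ρ)) (ψ ((⋃ i, E i).indicator ρ)) := by
  classical
  have hbd : ∀ A : Set X, MeasurableSet A → |ψ (A.indicator ρ)| ≤
      (C * mixN Q R (wt μ Ω a P ρ) ^ (1 / Q)).toReal := by
    intro A hA
    rw [← ENNReal.ofReal_le_iff_le_toReal (ENNReal.mul_ne_top hC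
      (ENNReal.rpow_ne_top_of_nonneg (by positivity) hG))]
    refine (F.bd _ (hρ.indicator hA) (rho_ind_ne_top H hQ hR hρ hG hA)).trans ?_
    refine mul_le_mul' le_rfl (ENNReal.rpow_le_rpow ?_ (by positivity))
    have := mixN_mul_le hQ hR (wt_le_mul H (hρ.indicator hA) hρ (c := 1) (fun x _ => by
      by_cases h : x ∈ A <;> simp [h]) a P)
    simpa using this
  set K := (C * mixN Q R (wt μ Ω a P ρ) ^ (1 / Q)).toReal
  have hS : Summable (fun i => ψ ((E i).indicator ρ)) := by
    apply Summable.of_abs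
    refine summable_of_sum_le (c := K + K) (fun _ => abs_nonneg _) fun s => ?_
    rw [← Finset.sum_filter_add_sum_filter_not s (fun i => 0 ≤ ψ ((E i).indicator ρ))]
    refine add_le_add ?_ ?_
    · rw [Finset.sum_congr rfl (g := fun i => ψ ((E i).indicator ρ))
        (fun i hi => abs_of_nonneg (Finset.mem_filter.1 hi).2),
        ← F.ind_finset H hQ hR hρ hG hE hd]
      exact (le_abs_self _).trans (hbd _ (Finset.measurableSet_biUnion _ fun i _ => hE i))
    · rw [Finset.sum_congr rfl (g := fun i => -ψ ((E i).indicator ρ))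
        (fun i hi => abs_of_neg (not_le.1 (Finset.mem_filter.1 hi).2)), Finset.sum_neg_distrib,
        ← F.ind_finset H hQ hR hρ hG hE hd]
      exact (neg_le_abs _).trans (hbd _ (Finset.measurableSet_biUnion _ fun i _ => hE i))
  rw [hS.hasSum_iff_tendsto_nat]
  have hU : MeasurableSet (⋃ i, E i) := MeasurableSet.iUnion hE
  have hV : ∀ n, MeasurableSet (⋃ i ∈ Finset.range n, E i) :=
    fun n => Finset.measurableSet_biUnion _ fun i _ => hE i
  have key : Tendsto (fun n => ψ ((⋃ i, E i).indicator ρ -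
      (⋃ i ∈ Finset.range n, E i).indicator ρ)) atTop (𝓝 0) := by
    refine F.tend hC H hQ hR hρ (fun n => (hρ.indicator hU).sub (hρ.indicator (hV n))) hG ?_ ?_
    · intro n x _
      have hsub : (⋃ i ∈ Finset.range n, E i) ⊆ ⋃ i, E i := iUnion₂_subset_iUnion _ _
      by_cases h1 : x ∈ ⋃ i ∈ Finset.range n, E i
      · have h2 := hsub h1
        rw [Pi.sub_apply, indicator_of_mem h1, indicator_of_mem h2]; simp
      · rw [Pi.sub_apply, indicator_of_notMem h1, sub_zero]
        by_cases h2 : x ∈ ⋃ i, E i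
        · rw [indicator_of_mem h2]
        · rw [indicator_of_notMem h2]; simp
    · intro x _
      apply tendsto_const_nhds.congr'
      by_cases h2 : x ∈ ⋃ i, E i
      · obtain ⟨i, hi⟩ := mem_iUnion.1 h2
        filter_upwards [eventually_gt_atTop i] with n hn
        have h1 : x ∈ ⋃ i ∈ Finset.range n, E i :=
          mem_iUnion₂.2 ⟨i, Finset.mem_range.2 hn, hi⟩
        rw [Pi.sub_apply, indicator_of_mem h1, indicator_of_mem h2]; simp
      · filter_upwards with n
        have h1 : x ∉ ⋃ i ∈ Finset.range n, E i := fun h => h2 (iUnion₂_subset_iUnion _ _ h)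
        rw [Pi.sub_apply, indicator_of_notMem h1, indicator_of_notMem h2]; simp
  have key2 : ∀ n, ψ ((⋃ i, E i).indicator ρ - (⋃ i ∈ Finset.range n, E i).indicator ρ) =
      ψ ((⋃ i, E i).indicator ρ) - ∑ i ∈ Finset.range n, ψ ((E i).indicator ρ) := by
    intro n
    rw [F.sub H hQ hR (hρ.indicator hU) (rho_ind_ne_top H hQ hR hρ hG hU) (hρ.indicator (hV n))
      (rho_ind_ne_top H hQ hR hρ hG (hV n)), F.ind_finset H hQ hR hρ hG hE hd]
  simp only [key2] at key
  have := tendsto_const_nhds (x := ψ ((⋃ i, E i).indicator ρ)).sub key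
  simpa using this

lemma Fnl.density (F : Fnl μ Ω a P Q R ψ C) [SigmaFinite μ] (hC : C ≠ ∞) (H : Good μ Ω)
    (hQ : 0 < Q) (hR : 0 < R)
    {ρ : X → ℝ} (hρ : Measurable ρ) (hG : mixN Q R (wt μ Ω a P ρ) ≠ ∞) :
    ∃ f : X → ℝ, Measurable f ∧ Integrable f (μ.restrict Ω) ∧ ∀ E, MeasurableSet E →
      ψ (E.indicator ρ) = ∫ x in E, f x ∂(μ.restrict Ω) := by
  classical
  let ν : SignedMeasure X :=
    { measureOf' := fun E => if MeasurableSet E then ψ (E.indicator ρ) else 0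
      empty' := by
        simp only [MeasurableSet.empty, if_true, indicator_empty]
        exact F.zero_ae H hQ hR measurable_const (by simp)
      not_measurable' := fun E hE => by simp [hE]
      m_iUnion' := fun E hE hd => by
        simp only [hE, MeasurableSet.iUnion hE, if_true]
        exact F.hasSum hC H hQ hR hρ hG hE hd }
  have hν : ∀ E, MeasurableSet E → ν E = ψ (E.indicator ρ) := fun E hE => if_pos hE
  have hac : ν ≪ᵥ (μ.restrict Ω).toENNRealVectorMeasure := by
    refine VectorMeasure.AbsolutelyContinuous.mk fun E hE h0 => ?_
    rw [Measure.toENNRealVectorMeasure_apply_measurable hE] at h0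
    rw [hν E hE]
    refine F.zero_ae H hQ hR (hρ.indicator hE) ?_
    filter_upwards [measure_eq_zero_iff_ae_notMem.1 h0] with x hx
    rw [indicator_of_notMem hx]
  have h1 := SignedMeasure.withDensityᵥ_rnDeriv_eq ν (μ.restrict Ω) hac
  refine ⟨ν.rnDeriv (μ.restrict Ω), SignedMeasure.measurable_rnDeriv _ _,
    SignedMeasure.integrable_rnDeriv _ _, fun E hE => ?_⟩
  rw [← hν E hE, ← withDensityᵥ_apply (SignedMeasure.integrable_rnDeriv _ _) hE, h1]

lemma Fnl.simple (F : Fnl μ Ω a P Q R ψ C) (H : Good μ Ω)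
    (hQ : 0 < Q) (hR : 0 < R)
    {ρ : X → ℝ} (hρ : Measurable ρ) (hG : mixN Q R (wt μ Ω a P ρ) ≠ ∞)
    {f : X → ℝ} (hi : Integrable f (μ.restrict Ω)) (hf : ∀ E, MeasurableSet E →
      ψ (E.indicator ρ) = ∫ x in E, f x ∂(μ.restrict Ω)) (s : SimpleFunc X ℝ) :
    mixN Q R (wt μ Ω a P (fun x => ρ x * s x)) ≠ ∞ ∧ Integrable (fun x => s x * f x) (μ.restrict Ω) ∧
    ψ (fun x => ρ x * s x) = ∫ x in Ω, s x * f x ∂μ := by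
  have hfin : ∀ s : SimpleFunc X ℝ, mixN Q R (wt μ Ω a P (fun x => ρ x * s x)) ≠ ∞ := by
    intro s
    obtain ⟨c, hc⟩ := s.exists_forall_norm_le
    refine mix_ne_top_of_le H (hρ.mul s.measurable) hρ hQ hR hG c ?_
    intro x _
    rw [Pi.mul_apply, abs_mul, mul_comm]
    exact mul_le_mul_of_nonneg_right (hc x) (abs_nonneg _)
  have hintg : ∀ s : SimpleFunc X ℝ, Integrable (fun x => s x * f x) (μ.restrict Ω) := by
    intro s
    obtain ⟨c, hc⟩ := s.exists_forall_norm_le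
    exact hi.bdd_mul s.measurable.aestronglyMeasurable (Eventually.of_forall hc)
  refine ⟨hfin s, hintg s, ?_⟩
  induction s using SimpleFunc.induction with
  | const c hs =>
    rename_i E
    have h1 : (fun x => ρ x * (SimpleFunc.piecewise E hs (SimpleFunc.const X c)
        (SimpleFunc.const X 0)) x) = c • E.indicator ρ := by
      funext x
      by_cases h : x ∈ E <;> simp [h, mul_comm]
    rw [h1, F.smul _ _ (hρ.indicator hs) (rho_ind_ne_top H hQ hR hρ hG hs), hf E hs,
      ← integral_const_mul, ← integral_indicator hs]
    congr 1
    funext x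
    by_cases h : x ∈ E <;> simp [h]
  | @add s t _ h1 h2 =>
    have hm : ∀ s : SimpleFunc X ℝ, Measurable fun x => ρ x * s x := fun s => hρ.mul s.measurable
    have h3 : (fun x => ρ x * (s + t) x) = (fun x => ρ x * s x) + (fun x => ρ x * t x) := by
      funext x; simp [mul_add]
    rw [h3, F.add _ _ (hm s) (hfin s) (hm t) (hfin t), h1, h2,
      ← integral_add (hintg s) (hintg t)]
    congr 1
    funext x
    simp [add_mul]

lemma Fnl.rep (F : Fnl μ Ω a P Q R ψ C) (hC : C ≠ ∞) (H : Good μ Ω)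
    (hQ : 0 < Q) (hR : 0 < R) (hΩ : MeasurableSet Ω)
    {ρ : X → ℝ} (hρ : Measurable ρ) (hρ0 : ∀ x ∈ Ω, 0 < ρ x) (hG : mixN Q R (wt μ Ω a P ρ) ≠ ∞)
    {f : X → ℝ} (hi : Integrable f (μ.restrict Ω)) (hf : ∀ E, MeasurableSet E →
      ψ (E.indicator ρ) = ∫ x in E, f x ∂(μ.restrict Ω)) {g : X → ℝ} (hg : Measurable g)
    (hg' : mixN Q R (wt μ Ω a P g) ≠ ∞) (hgf : Integrable (fun x => g x * (f x / ρ x)) (μ.restrict Ω)) :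
    ψ g = ∫ x in Ω, g x * (f x / ρ x) ∂μ := by
  have hk : Measurable fun x => g x / ρ x := hg.div hρ
  let s : ℕ → SimpleFunc X ℝ := fun n =>
    SimpleFunc.approxOn (fun x => g x / ρ x) hk univ 0 (mem_univ _) n
  have hlim : ∀ x, Tendsto (fun n => s n x) atTop (𝓝 (g x / ρ x)) := fun x =>
    SimpleFunc.tendsto_approxOn hk (mem_univ _) (by simp)
  have hb1 : ∀ n x, |s n x - g x / ρ x| ≤ |g x / ρ x| := by
    intro n x
    have := SimpleFunc.edist_approxOn_le hk (s := univ) (y₀ := 0) (mem_univ _) x n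
    rw [edist_dist, edist_dist, ENNReal.ofReal_le_ofReal_iff dist_nonneg, Real.dist_eq,
      Real.dist_eq, zero_sub, abs_neg] at this
    exact this
  have hb2 : ∀ n x, |s n x| ≤ 2 * |g x / ρ x| := by
    intro n x
    have := hb1 n x
    have h3 := abs_sub_abs_le_abs_sub (s n x) (g x / ρ x)
    linarith
  have hS := fun n => F.simple H hQ hR hρ hG hi hf (s n)
  have hmul : ∀ x ∈ Ω, ρ x * (g x / ρ x) = g x := fun x hx => by
    have := (hρ0 x hx).ne'
    field_simp
  have t1 : Tendsto (fun n => ψ ((fun x => ρ x * s n x) - g)) atTop (𝓝 0) := by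
    refine F.tend hC H hQ hR hg (fun n => (hρ.mul (s n).measurable).sub hg) hg' ?_ ?_
    · intro n x hx
      simp only [Pi.sub_apply]
      calc |ρ x * s n x - g x| = |ρ x * (s n x - g x / ρ x)| := by rw [mul_sub, hmul x hx]
        _ ≤ |ρ x * (g x / ρ x)| := by
          rw [abs_mul, abs_mul]
          exact mul_le_mul_of_nonneg_left (hb1 n x) (abs_nonneg _)
        _ = |g x| := by rw [hmul x hx]
    · intro x hx
      have := ((hlim x).const_mul (ρ x)).sub_const (g x)
      rw [hmul x hx, sub_self] at this
      exact this
  have t2 : Tendsto (fun n => ψ (fun x => ρ x * s n x)) atTop (𝓝 (ψ g)) := by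
    have := t1.add_const (ψ g)
    rw [zero_add] at this
    refine this.congr fun n => ?_
    have hm : Measurable fun x => ρ x * s n x := hρ.mul (s n).measurable
    rw [F.sub H hQ hR hm (hS n).1 hg hg']
    ring
  have t3 : Tendsto (fun n => ∫ x in Ω, s n x * f x ∂μ) atTop
      (𝓝 (∫ x in Ω, g x * (f x / ρ x) ∂μ)) := by
    refine tendsto_integral_of_dominated_convergence
      (fun x => 2 * |g x * (f x / ρ x)|) (fun n => (hS n).2.1.aestronglyMeasurable)
      (hgf.abs.const_mul 2) (fun n => ?_) ?_
    · filter_upwards with x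
      rw [Real.norm_eq_abs, abs_mul]
      have := mul_le_mul_of_nonneg_right (hb2 n x) (abs_nonneg (f x))
      refine this.trans (le_of_eq ?_)
      rw [mul_assoc, ← abs_mul]
      congr 2; ring
    · filter_upwards with x
      have := (hlim x).mul_const (f x)
      convert this using 2
      ring
  refine tendsto_nhds_unique t2 (t3.congr fun n => ?_)
  rw [(hS n).2.2]

end functional

section duality
variable {X : Type*} [MeasurableSpace X] [Norm X]
variable {μ : Measure X} [SFinite μ] {Ω : Set X} {a p P q Q r R : ℝ} {ψ : (X → ℝ) → ℝ} {C : ℝ≥0∞}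

lemma mixN_conv {w y : UU → ℤ → ℝ≥0∞} (hQ : 0 < Q) (hr : r.HolderConjugate R) {K : ℤ → ℝ≥0∞}
    (h : ∀ u i, w u i ≤ ∑' j, y u j * K (i - j)) :
    mixN Q R w ≤ (∑' m, K m) ^ Q * mixN Q R y := by
  have hR := hr.symm.pos
  rw [mixN, mixN, ← ENNReal.tsum_mul_left]
  apply ENNReal.tsum_le_tsum
  intro u
  calc _ ≤ ((∑' m, K m) ^ R * ∑' j, y u j ^ R) ^ (Q / R) := by
        refine ENNReal.rpow_le_rpow ?_ (by positivity)
        refine le_trans (ENNReal.tsum_le_tsum fun i => ENNReal.rpow_le_rpow (h u i) hR.le) ?_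
        exact young _ _ hr.symm
    _ = _ := by
        rw [ENNReal.mul_rpow_of_nonneg _ _ (by positivity), ← ENNReal.rpow_mul]
        congr 2
        field_simp

lemma Fnl.dual_fin (F : Fnl μ Ω (-a) P Q R ψ C) (hC : C ≠ ∞) (H : Good μ Ω)
    (hp : p.HolderConjugate P) (hq : q.HolderConjugate Q) (hr : r.HolderConjugate R)
    {f : X → ℝ} (hf : Measurable f) (hw : ∀ u j, wt μ Ω a p f u j ≠ ∞)
    (hrep : ∀ g : X → ℝ, Measurable g → mixN Q R (wt μ Ω (-a) P g) ≠ ∞ →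
      Integrable (fun x => g x * f x) (μ.restrict Ω) → ψ g = ∫ x in Ω, g x * f x ∂μ) :
    mixN q r (wt μ Ω a p f) ≠ ∞ := by
  have hQ := hq.symm.pos
  have hκ := Ker_sum hp.symm.lt
  set κ := ∑' m, Ker P m with hκd
  have hD : (C + 1) * (κ + 1) ≠ ∞ := ENNReal.mul_ne_top (by simp [hC]) (by simp [hκ])
  refine ne_top_of_le_ne_top (ENNReal.rpow_ne_top_of_nonneg hq.pos.le hD)
    (mix_dual _ hq hr hw ((C + 1) * (κ + 1)) ?_)
  intro S T y hy hyz
  by_cases hyt : mixN Q R y = ∞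
  · rw [hyt, ENNReal.top_rpow_of_pos (by positivity), ENNReal.mul_top (by simp)]
    exact le_top
  have hatt := fun (u : UU) (j : ℤ) =>
    Phi_att μ (hf.indicator (H.meas u)) (H.suppfin u f) (2 ^ (j:ℝ))
  choose φ φm φ1 φi φe using hatt
  set c : UU → ℤ → ℝ≥0∞ := fun u j => (2 ^ ((u.1:ℝ) * a) * y u j) * 2 ^ (-(j:ℝ) / P) with hc
  have hcz : ∀ u j, ¬(u ∈ S ∧ j ∈ T) → c u j = 0 := fun u j h => by simp [hc, hyz u j h]
  have hct : ∀ u j, c u j ≠ ∞ := fun u j =>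
    ENNReal.mul_ne_top (ENNReal.mul_ne_top (two_rpow_ne_top _) (hy u j)) (two_rpow_ne_top _)
  set Gu : UU → X → ℝ≥0∞ := fun u x => ∑' j, c u j * φ u j x with hGu
  have hGum : ∀ u, Measurable (Gu u) := fun u =>
    Measurable.ennreal_tsum fun j => (φm u j).const_mul _
  set G : X → ℝ≥0∞ := fun x => ∑' u : UU, (annulus Ω u.1).indicator (Gu u) x with hGd
  have hGm : Measurable G := Measurable.ennreal_tsum fun u => (hGum u).indicator (H.meas u)
  have hGA : ∀ u : UU, ∀ x ∈ annulus Ω u.1, G x = Gu u x := by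
    intro u x hx
    rw [hGd]
    simp only
    rw [tsum_eq_single u, indicator_of_mem hx]
    intro v hv
    exact indicator_of_notMem (fun h => (Set.disjoint_left.1 (H.disj hv) h hx)) _
  have hGut : ∀ u x, Gu u x ≠ ∞ := by
    intro u x
    rw [hGu]
    simp only
    rw [tsum_eq_sum (s := T)]
    · refine ENNReal.sum_ne_top.2 fun j _ => ENNReal.mul_ne_top (hct u j) ?_
      exact ne_top_of_le_ne_top (by simp) (φ1 u j x)
    · intro j hj
      rw [hcz u j (fun h => hj h.2), zero_mul]
  have hGt : ∀ x ∈ Ω, G x ≠ ∞ := by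
    intro x hx
    rw [← H.cov] at hx
    obtain ⟨u, hu⟩ := mem_iUnion.1 hx
    rw [hGA u x hu]
    exact hGut u x
  set g : X → ℝ := fun x => (if 0 ≤ f x then (1:ℝ) else -1) * (G x).toReal with hgd
  have hgm : Measurable g :=
    (Measurable.ite (measurableSet_le measurable_const hf) measurable_const measurable_const).mul
      hGm.ennreal_toReal
  have hgabs : ∀ x, |g x| = (G x).toReal := by
    intro x
    rw [hgd]
    simp only [abs_mul, abs_of_nonneg (ENNReal.toReal_nonneg (a := G x))]
    split_ifs <;> simp
  have hgf : ∀ x, g x * f x = (G x).toReal * |f x| := by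
    intro x
    rw [hgd]
    simp only
    split_ifs with h
    · rw [abs_of_nonneg h]; ring
    · rw [abs_of_neg (not_le.1 h)]; ring
  have hgo : ∀ x ∈ Ω, ENNReal.ofReal (g x * f x) = G x * ENNReal.ofReal |f x| := by
    intro x hx
    rw [hgf, ENNReal.ofReal_mul ENNReal.toReal_nonneg, ENNReal.ofReal_toReal (hGt x hx)]
  have hwg : ∀ u i, wt μ Ω (-a) P g u i ≤ ∑' j, y u j * Ker P (i - j) := by
    intro u i
    have hbu := block_upper μ (hgm.indicator (H.meas u)) (H.suppfin u g) (P := P)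
      (fun j => 2 ^ ((u.1:ℝ) * a) * y u j) (φ u) (φm u) (φ1 u) (φi u) (by
        intro x
        rw [ofReal_abs_indicator]
        by_cases hx : x ∈ annulus Ω u.1
        · rw [indicator_of_mem hx, hgabs]
          refine (ENNReal.ofReal_toReal_le).trans ?_
          rw [hGA u x hx]
        · rw [indicator_of_notMem hx]; exact zero_le) i
    rw [wt]
    refine (mul_le_mul' le_rfl hbu).trans (le_of_eq ?_)
    rw [← ENNReal.tsum_mul_left]
    congr 1
    funext j
    rw [← mul_assoc, ← mul_assoc, ← two_rpow_add]
    simp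
  have hmix := mixN_conv hQ hr hwg
  rw [← hκd] at hmix
  have hmixt : mixN Q R (wt μ Ω (-a) P g) ≠ ∞ := ne_top_of_le_ne_top
    (ENNReal.mul_ne_top (ENNReal.rpow_ne_top_of_nonneg hQ.le hκ) hyt) hmix
  have hΩm : MeasurableSet Ω := by rw [← H.cov]; exact MeasurableSet.iUnion H.meas
  have hfm : Measurable fun x => ENNReal.ofReal |f x| := by fun_prop
  have hE : ∫⁻ x in Ω, ENNReal.ofReal (g x * f x) ∂μ =
      ∑' u, ∑' j, y u j * wt μ Ω a p f u j := by
    rw [setLIntegral_congr_fun hΩm hgo]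
    nth_rewrite 1 [← H.cov]
    rw [lintegral_iUnion H.meas H.disj]
    congr 1
    funext u
    have h1 : ∫⁻ x in annulus Ω u.1, G x * ENNReal.ofReal |f x| ∂μ =
        ∫⁻ x, ∑' j, c u j * (φ u j x * ENNReal.ofReal |(annulus Ω u.1).indicator f x|) ∂μ := by
      rw [← lintegral_indicator (H.meas u)]
      congr 1
      funext x
      rw [ofReal_abs_indicator]
      by_cases hx : x ∈ annulus Ω u.1
      · rw [indicator_of_mem hx, indicator_of_mem hx, hGA u x hx, hGu]
        simp only
        rw [← ENNReal.tsum_mul_right]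
        simp only [mul_assoc]
      · rw [indicator_of_notMem hx, indicator_of_notMem hx]
        simp
    have him : Measurable fun x => ENNReal.ofReal |(annulus Ω u.1).indicator f x| := by
      have := hf.indicator (H.meas u)
      fun_prop
    have hpm : ∀ j, Measurable fun x =>
        φ u j x * ENNReal.ofReal |(annulus Ω u.1).indicator f x| := fun j => (φm u j).mul him
    rw [h1, lintegral_tsum fun j => ((hpm j).const_mul _).aemeasurable]
    congr 1
    funext j
    rw [lintegral_const_mul _ (hpm j), ← φe u j, wt, Wd, hc]
    have h2 : -(j:ℝ) / P = (j:ℝ) / p - j := by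
      have := hp.inv_add_inv_eq_one
      rw [div_eq_mul_inv, div_eq_mul_inv, show P⁻¹ = 1 - p⁻¹ by linarith]
      ring
    simp only
    rw [h2]
    ring
  have hEt : ∑' u, ∑' j, y u j * wt μ Ω a p f u j ≠ ∞ := by
    rw [tsum_eq_sum (s := S)]
    · refine ENNReal.sum_ne_top.2 fun u _ => ?_
      rw [tsum_eq_sum (s := T)]
      · exact ENNReal.sum_ne_top.2 fun j _ => ENNReal.mul_ne_top (hy u j) (hw u j)
      · intro j hj
        rw [hyz u j (fun h => hj h.2), zero_mul]
    · intro u hu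
      simp [fun j => hyz u j (fun h => hu h.1)]
  have hpos : ∀ x, 0 ≤ g x * f x := fun x => by rw [hgf]; positivity
  have hintg : Integrable (fun x => g x * f x) (μ.restrict Ω) := by
    refine ⟨(hgm.mul hf).aestronglyMeasurable, ?_⟩
    rw [hasFiniteIntegral_iff_ofReal (Eventually.of_forall hpos), hE]
    exact hEt.lt_top
  calc ∑' u, ∑' j, y u j * wt μ Ω a p f u j = ENNReal.ofReal (∫ x in Ω, g x * f x ∂μ) := by
        rw [ofReal_integral_eq_lintegral_ofReal hintg (Eventually.of_forall hpos), hE]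
    _ ≤ ENNReal.ofReal |ψ g| := by
        rw [hrep g hgm hmixt hintg]
        exact ENNReal.ofReal_le_ofReal (le_abs_self _)
    _ ≤ C * mixN Q R (wt μ Ω (-a) P g) ^ (1 / Q) := F.bd g hgm hmixt
    _ ≤ C * (κ ^ Q * mixN Q R y) ^ (1 / Q) :=
        mul_le_mul' le_rfl (ENNReal.rpow_le_rpow hmix (by positivity))
    _ = C * κ * mixN Q R y ^ (1 / Q) := by
        rw [ENNReal.mul_rpow_of_nonneg _ _ (by positivity), ← ENNReal.rpow_mul,
          mul_one_div_cancel hQ.ne', ENNReal.rpow_one, mul_assoc]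
    _ ≤ _ := mul_le_mul' (mul_le_mul' le_self_add le_self_add) le_rfl

theorem Fnl.main (F : Fnl μ Ω (-a) P Q R ψ C) [SigmaFinite μ] (hC : C ≠ ∞) (H : Good μ Ω)
    (hp : p.HolderConjugate P) (hq : q.HolderConjugate Q) (hr : r.HolderConjugate R) :
    ∃ f : X → ℝ, Measurable f ∧ mixN q r (wt μ Ω a p f) ≠ ∞ ∧
      ∀ g : X → ℝ, Measurable g → mixN Q R (wt μ Ω (-a) P g) ≠ ∞ →
        ψ g = ∫ x in Ω, g x * f x ∂μ := by
  have hQ := hq.symm.pos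
  have hR := hr.symm.pos
  have hΩm : MeasurableSet Ω := by rw [← H.cov]; exact MeasurableSet.iUnion H.meas
  obtain ⟨ρ, c, hρ, hc, hρc, hρt⟩ := exists_rho (a := -a) H hp.symm.lt hQ hr.symm
  have hρ0 : ∀ x ∈ Ω, 0 < ρ x := by
    intro x hx
    rw [← H.cov] at hx
    obtain ⟨u, hu⟩ := mem_iUnion.1 hx
    rw [hρc u x hu]
    exact hc u
  obtain ⟨k, hk, hki, hkE⟩ := F.density hC H hQ hR hρ hρt
  have hf : Measurable fun x => k x / ρ x := hk.div hρ
  have hrep : ∀ g : X → ℝ, Measurable g → mixN Q R (wt μ Ω (-a) P g) ≠ ∞ →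
      Integrable (fun x => g x * (k x / ρ x)) (μ.restrict Ω) →
      ψ g = ∫ x in Ω, g x * (k x / ρ x) ∂μ := fun g hg hg' hi =>
    F.rep hC H hQ hR hΩm hρ hρ0 hρt hki hkE hg hg' hi
  have hw : ∀ u j, wt μ Ω a p (fun x => k x / ρ x) u j ≠ ∞ := by
    intro u j
    refine ne_top_of_le_ne_top ?_ (wt_le_lint H hf a p u j)
    refine ENNReal.mul_ne_top (ENNReal.mul_ne_top (two_rpow_ne_top _) (two_rpow_ne_top _)) ?_
    have h1 : IntegrableOn (fun x => k x / c u) (annulus Ω u.1) μ :=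
      (IntegrableOn.mono_set hki (H.sub u)).div_const _
    have h2 : ∫⁻ x in annulus Ω u.1, ENNReal.ofReal |k x / ρ x| ∂μ =
        ∫⁻ x in annulus Ω u.1, ENNReal.ofReal |k x / c u| ∂μ :=
      setLIntegral_congr_fun (H.meas u) fun x hx => by simp only [hρc u x hx]
    rw [h2]
    have := (hasFiniteIntegral_iff_norm _).1 h1.2
    exact this.ne
  have hfin := F.dual_fin hC H hp hq hr hf hw hrep
  refine ⟨_, hf, hfin, fun g hg hg' => hrep g hg hg' ?_⟩
  refine ⟨(hg.mul hf).aestronglyMeasurable, ?_⟩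
  rw [hasFiniteIntegral_iff_norm]
  have h1 := (global_holder (a := a) H hf hg hp).trans
    (mul_le_mul' le_rfl (mix_holder _ _ hq hr))
  refine lt_of_le_of_lt (le_trans (le_of_eq ?_) h1) ?_
  · congr 1
    funext x
    rw [Real.norm_eq_abs, abs_mul, mul_comm, ENNReal.ofReal_mul (abs_nonneg _)]
  · refine (ENNReal.mul_ne_top (by simp) (ENNReal.mul_ne_top ?_ ?_)).lt_top
    · exact ENNReal.rpow_ne_top_of_nonneg (by have := hq.pos; positivity) hfin
    · exact ENNReal.rpow_ne_top_of_nonneg (by positivity) hg'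

end duality

section euclid

lemma conjExp_spec {p : ℝ≥0∞} (h1 : 1 < p) (h : p ≠ ∞) :
    p.toReal.HolderConjugate (conjExp p).toReal := by
  have hp : 1 < p.toReal := by
    rw [← ENNReal.toReal_one]
    exact (ENNReal.toReal_lt_toReal (by simp) h).2 h1
  have h2 := Real.HolderConjugate.conjExponent hp
  rw [conjExp, if_neg h1.ne', if_neg h, ENNReal.toReal_ofReal]
  · exact h2
  · exact h2.symm.nonneg

lemma good_euc {N : ℕ} (Ω : Set (Euc N)) (hΩ : MeasurableSet Ω) : Good volume Ω := by
  have hn : Measurable fun x : Euc N => ‖x‖ := measurable_norm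
  have bd : ∀ (u : UU) (x : Euc N), x ∈ annulus Ω u.1 → x ∈ Ω ∧ ‖x‖ < (2:ℝ) ^ u.1 := by
    rintro ⟨u, hu⟩ x hx
    simp only [annulus] at hx ⊢
    split_ifs at hx with h
    · subst h
      refine ⟨hx.1, ?_⟩
      have := hx.2
      norm_num at this ⊢
      exact this
    · exact ⟨hx.1, hx.2.2⟩
  have lb : ∀ (u v : UU) (x : Euc N), x ∈ annulus Ω u.1 → u.1 < v.1 → x ∉ annulus Ω v.1 := by
    rintro u ⟨v, hv⟩ x hx huv hxv
    have h1 := (bd u x hx).2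
    have h0 := u.2
    simp only [annulus] at hxv huv
    rw [if_neg (by omega)] at hxv
    have h2 : (2:ℝ) ^ u.1 ≤ 2 ^ (v - 1) := zpow_le_zpow_right₀ (by norm_num) (by omega)
    linarith [hxv.2.1]
  refine ⟨?_, ?_, ?_, ?_⟩
  · rintro ⟨u, hu⟩
    simp only [annulus]
    split_ifs
    · exact hΩ.inter (measurableSet_lt hn measurable_const)
    · exact hΩ.inter ((measurableSet_le measurable_const hn).inter
        (measurableSet_lt hn measurable_const))
  · intro u
    refine ne_top_of_le_ne_top (measure_ball_lt_top (μ := (volume : Measure (Euc N)))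
      (x := 0) (r := (2:ℝ) ^ u.1)).ne ?_
    refine measure_mono fun x hx => ?_
    rw [mem_ball_zero_iff]
    exact (bd u x hx).2
  · intro u v huv
    rw [Set.disjoint_left]
    intro x hx hxv
    have huv' : u.1 ≠ v.1 := fun h => huv (Subtype.ext h)
    rcases lt_or_gt_of_ne huv' with h | h
    · exact lb u v x hx h hxv
    · exact lb v u x hxv h hx
  · apply Subset.antisymm
    · exact iUnion_subset fun u x hx => (bd u x hx).1
    · intro x hx
      rw [mem_iUnion]
      by_cases h : ‖x‖ < 1 / 2
      · exact ⟨⟨-1, le_rfl⟩, by simp only [annulus, if_true]; exact ⟨hx, h⟩⟩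
      · have hx0 : 0 < ‖x‖ := by linarith
        obtain ⟨n, h1, h2⟩ := exists_mem_Ico_zpow hx0 (by norm_num : (1:ℝ) < 2)
        have h3 : -1 < n + 1 := by
          rw [← zpow_lt_zpow_iff_right₀ (by norm_num : (1:ℝ) < 2)]
          refine lt_of_le_of_lt ?_ h2
          norm_num at h ⊢
          exact h
        refine ⟨⟨n + 1, h3.le⟩, ?_⟩
        simp only [annulus]
        rw [if_neg (by omega)]
        exact ⟨hx, by simpa using h1, h2⟩

end euclid

/-- For `a ∈ ℝ` and `1 < p, q, r < ∞`, the Banach space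
`(HL^{a,r}_{p,q}(Ω), ‖·‖*)` is reflexive.  Since its dual is canonically
identified with `(HL^{-a,r'}_{p',q'}(Ω), ‖·‖*)` via the integral pairing,
reflexivity is expressed as: every bounded linear functional `ψ` on the dual
space `HL^{-a,r'}_{p',q'}(Ω)` is given by integration against a (fixed) element
`f` of `HL^{a,r}_{p,q}(Ω)`, i.e. the canonical embedding into the bidual is
surjective. -/
theorem lorentzHerz_reflexive {N : ℕ} (hN : 1 ≤ N)
    (Ω : Set (Euc N)) (hΩ : MeasurableSet Ω)
    (a : ℝ) (p q r : ℝ≥0∞) (hp1 : 1 < p) (hp : p ≠ ∞)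
    (hq1 : 1 < q) (hq : q ≠ ∞) (hr1 : 1 < r) (hr : r ≠ ∞) :
    ∀ ψ : (Euc N → ℝ) → ℝ,
      (∀ g₁ g₂ : Euc N → ℝ,
        Measurable g₁ →
          herzNormStar volume Ω (-a) (conjExp p) (conjExp q) (conjExp r) g₁ < ∞ →
        Measurable g₂ →
          herzNormStar volume Ω (-a) (conjExp p) (conjExp q) (conjExp r) g₂ < ∞ →
          ψ (g₁ + g₂) = ψ g₁ + ψ g₂) →
      (∀ (c : ℝ) (g : Euc N → ℝ), Measurable g →
        herzNormStar volume Ω (-a) (conjExp p) (conjExp q) (conjExp r) g < ∞ →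
          ψ (c • g) = c * ψ g) →
      (∃ C : ℝ, 0 ≤ C ∧ ∀ g : Euc N → ℝ, Measurable g →
        herzNormStar volume Ω (-a) (conjExp p) (conjExp q) (conjExp r) g < ∞ →
          |ψ g| ≤ C * (herzNormStar volume Ω (-a) (conjExp p) (conjExp q)
            (conjExp r) g).toReal) →
      ∃ f : Euc N → ℝ, Measurable f ∧ herzNormStar volume Ω a p q r f < ∞ ∧
        ∀ g : Euc N → ℝ, Measurable g →
          herzNormStar volume Ω (-a) (conjExp p) (conjExp q) (conjExp r) g < ∞ →
            ψ g = ∫ x in Ω, g x * f x ∂volume := by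
  intro ψ hadd hsmul hbd
  obtain ⟨C, hC0, hC⟩ := hbd
  have H := good_euc Ω hΩ
  have cp := conjExp_spec hp1 hp
  have cq := conjExp_spec hq1 hq
  have cr := conjExp_spec hr1 hr
  have hle := fun g : Euc N → ℝ => herz_le (p := conjExp p) (q := conjExp q) (r := conjExp r)
    volume Ω (-a) g cp.symm.pos cq.symm.pos cr.symm.lt
  have hlt : ∀ g : Euc N → ℝ, mixN (conjExp q).toReal (conjExp r).toReal
      (wt volume Ω (-a) (conjExp p).toReal g) ≠ ∞ →
      herzNormStar volume Ω (-a) (conjExp p) (conjExp q) (conjExp r) g < ∞ := fun g hg =>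
    (hle g).trans_lt (ENNReal.mul_ne_top (by simp)
      (ENNReal.rpow_ne_top_of_nonneg (inv_nonneg.2 cq.symm.nonneg) hg)).lt_top
  have F : Fnl volume Ω (-a) (conjExp p).toReal (conjExp q).toReal (conjExp r).toReal ψ
      (ENNReal.ofReal C * 4) := by
    refine ⟨fun g h hg hg' hh hh' => hadd g h hg (hlt g hg') hh (hlt h hh'),
      fun c g hg hg' => hsmul c g hg (hlt g hg'), fun g hg hg' => ?_⟩
    refine (ENNReal.ofReal_le_ofReal (hC g hg (hlt g hg'))).trans ?_
    rw [ENNReal.ofReal_mul hC0, ENNReal.ofReal_toReal (hlt g hg').ne, mul_assoc, one_div]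
    exact mul_le_mul' le_rfl (hle g)
  obtain ⟨f, hf, hf', hrep⟩ := F.main (ENNReal.mul_ne_top ENNReal.ofReal_ne_top (by simp)) H cp cq cr
  refine ⟨f, hf, ?_, fun g hg hg' => hrep g hg ?_⟩
  · refine (herz_le (p := p) (q := q) (r := r) volume Ω a f cp.pos cq.pos cr.lt).trans_lt ?_
    exact (ENNReal.mul_ne_top (by simp)
      (ENNReal.rpow_ne_top_of_nonneg (inv_nonneg.2 cq.nonneg) hf')).lt_top
  · intro h
    have := herz_ge (p := conjExp p) (q := conjExp q) (r := conjExp r)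
      volume Ω (-a) g cp.symm.pos cq.symm.pos cr.symm.lt
    rw [h, ENNReal.top_rpow_of_pos (inv_pos.2 cq.symm.pos), top_le_iff] at this
    exact ENNReal.mul_ne_top (by simp) hg'.ne this
end

section
/- Let 0 < θ < 1, 0 < p < ∞, 0 < q₀, q₁, q, r ≤ ∞ and a₀ ≠ a₁ ∈ ℝ, and set a = (1−θ)a₀ + θa₁. Let X₀ = HL^{a₀,r}_{p,q₀}(Ω) and X₁ = HL^{a₁,r}_{p,q₁}(Ω). Then the real interpolation space (X₀, X₁)_{θ,q} coincides with HL^{a,r}_{p,q}(Ω), with equivalent quasi-norms: there exist constants 0 < c ≤ C < ∞ such that for every f ∈ X₀ + X₁, c·‖f‖_{HL^{a,r}_{p,q}} ≤ ‖f‖_{(X₀,X₁)_{θ,q}} ≤ C·‖f‖_{HL^{a,r}_{p,q}}. -/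
open MeasureTheory ENNReal Set Filter Topology

/-- Weight. -/
noncomputable def lhW (a : ℝ) (u : ℤ) : ℝ≥0∞ := ENNReal.ofReal ((2 : ℝ) ^ ((u : ℝ) * a))

/-- Decay function. -/
noncomputable def lhPhi (e x : ℝ) : ℝ≥0∞ := ENNReal.ofReal ((min x x⁻¹) ^ e)

lemma lh_scale (G : ℝ → ℝ≥0∞) (c : ℝ) (hc : 0 < c) :
    ∫⁻ t in Set.Ioi (0 : ℝ), G (c * t) / ENNReal.ofReal t
      = ∫⁻ t in Set.Ioi (0 : ℝ), G t / ENNReal.ofReal t := by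
  rw [← lintegral_indicator measurableSet_Ioi, ← lintegral_indicator measurableSet_Ioi]
  set H : ℝ → ℝ≥0∞ := (Set.Ioi (0 : ℝ)).indicator (fun t => G t / ENNReal.ofReal t) with hH
  have h1 : ∀ t, (Set.Ioi (0 : ℝ)).indicator (fun t => G (c * t) / ENNReal.ofReal t) t
      = ENNReal.ofReal c * H (c * t) := by
    intro t
    by_cases ht : 0 < t
    · have hct : 0 < c * t := mul_pos hc ht
      rw [hH, Set.indicator_of_mem (by exact ht), Set.indicator_of_mem (by exact hct)]
      rw [ENNReal.ofReal_mul hc.le, div_eq_mul_inv, div_eq_mul_inv,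
        ENNReal.mul_inv (Or.inl (by simpa using hc)) (Or.inl ENNReal.ofReal_ne_top)]
      have : ENNReal.ofReal c * (ENNReal.ofReal c)⁻¹ = 1 :=
        ENNReal.mul_inv_cancel (by simpa using hc) ENNReal.ofReal_ne_top
      calc _ = (ENNReal.ofReal c * (ENNReal.ofReal c)⁻¹) * (G (c * t) * (ENNReal.ofReal t)⁻¹) := by
            rw [this, one_mul]
        _ = _ := by ring
    · have hct : ¬ 0 < c * t := by
        intro h; exact ht (pos_of_mul_pos_right h hc.le)
      rw [hH, Set.indicator_of_notMem (by exact ht), Set.indicator_of_notMem (by exact hct), mul_zero]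
  simp_rw [h1]
  rw [lintegral_const_mul' _ _ ENNReal.ofReal_ne_top]
  have h2 := Real.smul_map_volume_mul_left (a := c) hc.ne'
  have h3 : ∫⁻ t, H (c * t) = ∫⁻ t, H t ∂(Measure.map (c * ·) volume) := by
    have := lintegral_map_equiv (μ := (volume : Measure ℝ)) H
      (Homeomorph.mulLeft₀ c hc.ne').toMeasurableEquiv
    simpa using this.symm
  rw [h3, ← smul_eq_mul, ← lintegral_smul_measure]
  rw [abs_of_pos hc] at h2
  rw [h2]

lemma lh_rearr_add {X : Type*} [MeasurableSpace X] (μ : Measure X) (f g : X → ℝ) (t : ℝ)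
    (ht : 0 < t) :
    rearr μ (f + g) t ≤ rearr μ f (2⁻¹ * t) + rearr μ g (2⁻¹ * t) := by
  unfold rearr
  rw [ENNReal.sInf_add]
  refine le_iInf₂ fun α hα => ?_
  rw [add_comm α, ENNReal.sInf_add]
  refine le_iInf₂ fun β hβ => ?_
  apply sInf_le
  simp only [Set.mem_ofPred_eq] at hα hβ ⊢
  calc μ {x | β + α < ENNReal.ofReal |(f + g) x|}
      ≤ μ ({x | α < ENNReal.ofReal |f x|} ∪ {x | β < ENNReal.ofReal |g x|}) := by
        apply measure_mono
        intro x hx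
        simp only [Set.mem_ofPred_eq, Set.mem_union, Pi.add_apply] at hx ⊢
        by_contra! h
        refine absurd hx (not_lt.mpr ?_)
        calc ENNReal.ofReal |f x + g x| ≤ ENNReal.ofReal (|f x| + |g x|) :=
              ENNReal.ofReal_le_ofReal (abs_add_le _ _)
          _ ≤ ENNReal.ofReal |f x| + ENNReal.ofReal |g x| := ENNReal.ofReal_add_le
          _ ≤ α + β := add_le_add h.1 h.2
          _ = β + α := add_comm _ _
    _ ≤ _ := measure_union_le _ _
    _ ≤ ENNReal.ofReal (2⁻¹ * t) + ENNReal.ofReal (2⁻¹ * t) := add_le_add hα hβ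
    _ = ENNReal.ofReal t := by
        rw [← ENNReal.ofReal_add (by positivity) (by positivity)]; congr 1; ring

lemma lh_rearr_antitone {X : Type*} [MeasurableSpace X] (μ : Measure X) (f : X → ℝ) :
    Antitone (rearr μ f) := by
  intro s t hst
  apply sInf_le_sInf
  intro α hα
  exact le_trans hα (ENNReal.ofReal_le_ofReal hst)

lemma lh_rearr_zero {X : Type*} [MeasurableSpace X] (μ : Measure X) (t : ℝ) :
    rearr μ (0 : X → ℝ) t = 0 := by
  unfold rearr
  apply le_antisymm _ bot_le
  apply sInf_le
  simp

lemma lh_lorentz_zero {X : Type*} [MeasurableSpace X] (μ : Measure X) (p r : ℝ≥0∞) (hr : 0 < r) :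
    lorentzNorm μ p r (0 : X → ℝ) = 0 := by
  unfold lorentzNorm lorentzNormOf
  split_ifs with h
  · simp [lh_rearr_zero]
  · have : 0 < r.toReal := ENNReal.toReal_pos hr.ne' h
    simp [lh_rearr_zero, this]

lemma lh_add_rpow_le (x y : ℝ≥0∞) (r : ℝ) (hr : 0 ≤ r) :
    (x + y) ^ r ≤ 2 ^ r * (x ^ r + y ^ r) := by
  rcases le_total x y with h | h
  · calc (x + y) ^ r ≤ (2 * y) ^ r := by
          apply ENNReal.rpow_le_rpow _ hr
          rw [two_mul]; exact add_le_add_left h _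
      _ = 2 ^ r * y ^ r := ENNReal.mul_rpow_of_nonneg _ _ hr
      _ ≤ _ := by gcongr; exact le_add_self
  · calc (x + y) ^ r ≤ (2 * x) ^ r := by
          apply ENNReal.rpow_le_rpow _ hr
          rw [two_mul]; exact add_le_add_right h _
      _ = 2 ^ r * x ^ r := ENNReal.mul_rpow_of_nonneg _ _ hr
      _ ≤ _ := by gcongr; exact le_self_add

lemma lh_quasi {X : Type*} [MeasurableSpace X] (μ : Measure X) (p r : ℝ≥0∞) (hr : 0 < r) :
    ∃ κ : ℝ≥0∞, κ ≠ 0 ∧ κ ≠ ∞ ∧ ∀ f g : X → ℝ,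
      lorentzNorm μ p r (f + g) ≤ κ * (lorentzNorm μ p r f + lorentzNorm μ p r g) := by
  set s := p.toReal⁻¹ with hs
  set D : ℝ≥0∞ := ENNReal.ofReal ((2 : ℝ) ^ s) with hD
  have hD0 : D ≠ 0 := by simp only [hD, ne_eq, ENNReal.ofReal_eq_zero, not_le]; positivity
  have hDt : D ≠ ∞ := ENNReal.ofReal_ne_top
  have key : ∀ (f g : X → ℝ) (t : ℝ), 0 < t →
      ENNReal.ofReal (t ^ s) * rearr μ (f + g) t ≤
        D * (ENNReal.ofReal ((2⁻¹ * t) ^ s) * rearr μ f (2⁻¹ * t)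
          + ENNReal.ofReal ((2⁻¹ * t) ^ s) * rearr μ g (2⁻¹ * t)) := by
    intro f g t ht
    have : ENNReal.ofReal (t ^ s) = D * ENNReal.ofReal ((2⁻¹ * t) ^ s) := by
      rw [hD, ← ENNReal.ofReal_mul (by positivity), ← Real.mul_rpow (by norm_num) (by positivity)]
      congr 2; ring
    rw [this, ← mul_add, mul_assoc]
    gcongr
    exact lh_rearr_add μ f g t ht
  by_cases hrt : r = ∞
  · refine ⟨D, hD0, hDt, fun f g => ?_⟩
    unfold lorentzNorm lorentzNormOf
    simp only [hrt, if_true]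
    apply iSup_le
    rintro ⟨t, ht⟩
    refine (key f g t ht).trans ?_
    gcongr
    · exact le_iSup (fun t : {t : ℝ // 0 < t} => ENNReal.ofReal (t.1 ^ s) * rearr μ f t.1)
        ⟨2⁻¹ * t, by positivity⟩
    · exact le_iSup (fun t : {t : ℝ // 0 < t} => ENNReal.ofReal (t.1 ^ s) * rearr μ g t.1)
        ⟨2⁻¹ * t, by positivity⟩
  · have hr' : 0 < r.toReal := ENNReal.toReal_pos hr.ne' hrt
    set ρ := r.toReal
    refine ⟨2 * D * 2 ^ (ρ⁻¹), ?_, ?_, fun f g => ?_⟩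
    · refine mul_ne_zero (mul_ne_zero two_ne_zero hD0) ?_
      simp [ENNReal.rpow_eq_zero_iff]
    · exact ENNReal.mul_ne_top (ENNReal.mul_ne_top (by simp) hDt)
        (ENNReal.rpow_ne_top_of_nonneg (by positivity) (by simp))
    unfold lorentzNorm lorentzNormOf
    simp only [hrt, if_false]
    set Gf : ℝ → ℝ≥0∞ := fun t => (ENNReal.ofReal (t ^ s) * rearr μ f t) ^ ρ with hGf
    set Gg : ℝ → ℝ≥0∞ := fun t => (ENNReal.ofReal (t ^ s) * rearr μ g t) ^ ρ with hGg
    have hmeas : Measurable Gf := by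
      have := (lh_rearr_antitone μ f).measurable
      fun_prop
    have h1 : ∫⁻ t in Set.Ioi (0 : ℝ),
        (ENNReal.ofReal (t ^ s) * rearr μ (f + g) t) ^ ρ / ENNReal.ofReal t
        ≤ (D * 2) ^ ρ * ((∫⁻ t in Set.Ioi (0 : ℝ), Gf t / ENNReal.ofReal t)
          + ∫⁻ t in Set.Ioi (0 : ℝ), Gg t / ENNReal.ofReal t) := by
      rw [← lh_scale Gf 2⁻¹ (by norm_num), ← lh_scale Gg 2⁻¹ (by norm_num),
        ← lintegral_add_left (by fun_prop), ← lintegral_const_mul' _ _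
          (ENNReal.rpow_ne_top_of_nonneg hr'.le (ENNReal.mul_ne_top hDt (by simp)))]
      apply setLIntegral_mono' measurableSet_Ioi
      intro t ht
      rw [ENNReal.div_add_div_same, ← mul_div_assoc]
      gcongr
      refine (ENNReal.rpow_le_rpow (key f g t ht) hr'.le).trans ?_
      rw [ENNReal.mul_rpow_of_nonneg _ _ hr'.le, ENNReal.mul_rpow_of_nonneg _ _ hr'.le, mul_assoc]
      gcongr
      exact lh_add_rpow_le _ _ _ hr'.le
    refine (ENNReal.rpow_le_rpow h1 (by positivity)).trans ?_
    rw [ENNReal.mul_rpow_of_nonneg _ _ (by positivity), ENNReal.rpow_rpow_inv hr'.ne']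
    calc _ ≤ D * 2 * (2 ^ ρ⁻¹ * _) := by
          gcongr; exact lh_add_rpow_le _ _ _ (by positivity)
      _ = _ := by ring

lemma lhPhi_rpow (e x q : ℝ) (hx : 0 < x) : lhPhi e x ^ q = lhPhi (e * q) x := by
  have hm : 0 < min x x⁻¹ := lt_min hx (inv_pos.mpr hx)
  unfold lhPhi
  rw [ENNReal.ofReal_rpow_of_pos (by positivity), ← Real.rpow_mul hm.le]

lemma lhPhi_le_one (e x : ℝ) (hx : 0 < x) (he : 0 ≤ e) : lhPhi e x ≤ 1 := by
  have hm : 0 < min x x⁻¹ := lt_min hx (inv_pos.mpr hx)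
  unfold lhPhi
  rw [ENNReal.ofReal_le_one]
  apply Real.rpow_le_one hm.le _ he
  rcases le_total x 1 with h | h
  · exact (min_le_left _ _).trans h
  · exact (min_le_right _ _).trans (inv_le_one_of_one_le₀ h)

lemma lhPhi_two_rpow (e y : ℝ) :
    lhPhi e ((2 : ℝ) ^ y) = ENNReal.ofReal ((2 : ℝ) ^ (-(e * |y|))) := by
  unfold lhPhi
  have : min ((2 : ℝ) ^ y) ((2 : ℝ) ^ y)⁻¹ = (2 : ℝ) ^ (-|y|) := by
    rw [← Real.rpow_neg (by norm_num)]
    rcases le_total 0 y with h | h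
    · rw [abs_of_nonneg h, min_eq_right]
      exact Real.rpow_le_rpow_of_exponent_le (by norm_num) (by linarith)
    · rw [abs_of_nonpos h, min_eq_left, neg_neg]
      exact Real.rpow_le_rpow_of_exponent_le (by norm_num) (by linarith)
  rw [this, ← Real.rpow_mul (by norm_num)]
  congr 2; ring

lemma lh_sum_bound (d η : ℝ) (hd : d ≠ 0) (hη : 0 < η) :
    ∃ C : ℝ≥0∞, C ≠ ∞ ∧ ∀ t : ℝ, 0 < t →
      ∑' u : {u : ℤ // -1 ≤ u}, lhPhi η (t / (2 : ℝ) ^ ((u.1 : ℝ) * d)) ≤ C := by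
  set ρ : ℝ := (2 : ℝ) ^ (-(η * |d|)) with hρ
  have hρ0 : 0 < ρ := by positivity
  have hρ1 : ρ < 1 := by
    apply Real.rpow_lt_one_of_one_lt_of_neg (by norm_num)
    have : 0 < η * |d| := by positivity
    linarith
  have hsum : Summable (fun j : ℤ => ρ ^ j.natAbs) := by
    apply Summable.of_nat_of_neg
    · simpa using summable_geometric_of_lt_one hρ0.le hρ1
    · simpa using summable_geometric_of_lt_one hρ0.le hρ1
  refine ⟨ENNReal.ofReal ρ⁻¹ * ∑' j : ℤ, ENNReal.ofReal (ρ ^ j.natAbs),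
    ENNReal.mul_ne_top ENNReal.ofReal_ne_top hsum.tsum_ofReal_ne_top, fun t ht => ?_⟩
  set τ := Real.logb 2 t with hτ
  have htτ : (2 : ℝ) ^ τ = t := Real.rpow_logb (by norm_num) (by norm_num) ht
  set k : ℤ := ⌊τ / d⌋ with hk
  have hterm : ∀ u : ℤ, lhPhi η (t / (2 : ℝ) ^ ((u : ℝ) * d))
      ≤ ENNReal.ofReal ρ⁻¹ * ENNReal.ofReal (ρ ^ (k - u).natAbs) := by
    intro u
    rw [← htτ, ← Real.rpow_sub (by norm_num), lhPhi_two_rpow,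
      ← ENNReal.ofReal_mul (by positivity)]
    apply ENNReal.ofReal_le_ofReal
    have e1 : ρ⁻¹ * ρ ^ (k - u).natAbs = (2 : ℝ) ^ (-(η * |d| * (|(k : ℝ) - u| - 1))) := by
      have : (((k - u).natAbs : ℕ) : ℝ) = |(k : ℝ) - u| := by
        rw [Nat.cast_natAbs]; push_cast; rfl
      rw [← Real.rpow_natCast, this, hρ, ← Real.rpow_neg (by norm_num), ← Real.rpow_mul (by norm_num),
        ← Real.rpow_add (by norm_num)]
      congr 1; ring
    rw [e1]
    apply Real.rpow_le_rpow_of_exponent_le (by norm_num)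
    have e2 : |τ - u * d| = |d| * |τ / d - u| := by
      rw [← abs_mul]; congr 1; field_simp
    rw [e2]
    have e3 : |(k : ℝ) - u| - 1 ≤ |τ / d - u| := by
      have h1 : (k : ℝ) ≤ τ / d := Int.floor_le _
      have h2 : τ / d < k + 1 := Int.lt_floor_add_one _
      have h3 : |(k : ℝ) - u| ≤ |τ / d - u| + |k - τ / d| := by
        have := abs_add_le (τ / d - u) (k - τ / d)
        have h4 : τ / d - u + (k - τ / d) = (k : ℝ) - u := by ring
        rwa [h4] at this
      have h5 : |(k : ℝ) - τ / d| ≤ 1 := by rw [abs_le]; constructor <;> linarith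
      linarith
    have : η * |d| * (|(k : ℝ) - u| - 1) ≤ η * |d| * |τ / d - u| :=
      mul_le_mul_of_nonneg_left e3 (by positivity)
    linarith
  calc _ ≤ ∑' u : {u : ℤ // -1 ≤ u},
        ENNReal.ofReal ρ⁻¹ * ENNReal.ofReal (ρ ^ (k - u.1).natAbs) :=
        ENNReal.tsum_le_tsum fun u => hterm u.1
    _ ≤ ∑' u : ℤ, ENNReal.ofReal ρ⁻¹ * ENNReal.ofReal (ρ ^ (k - u).natAbs) :=
        ENNReal.tsum_comp_le_tsum_of_injective Subtype.val_injective
          (fun u : ℤ => ENNReal.ofReal ρ⁻¹ * ENNReal.ofReal (ρ ^ (k - u).natAbs))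
    _ = ENNReal.ofReal ρ⁻¹ * ∑' u : ℤ, ENNReal.ofReal (ρ ^ (k - u).natAbs) := ENNReal.tsum_mul_left
    _ = _ := by
        congr 1
        exact (Equiv.subLeft k).tsum_eq (fun j : ℤ => ENNReal.ofReal (ρ ^ j.natAbs))

lemma lh_int_bound (η : ℝ) (hη : 0 < η) :
    ∫⁻ t in Set.Ioi (0 : ℝ), lhPhi η t / ENNReal.ofReal t ≠ ∞ := by
  have hu : Set.Ioi (0 : ℝ) = Set.Ioc 0 1 ∪ Set.Ioi 1 := by
    rw [Set.Ioc_union_Ioi_eq_Ioi (by norm_num)]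
  rw [hu]
  apply ne_top_of_le_ne_top _ (lintegral_union_le _ _ _)
  have h1 : ∫⁻ t in Set.Ioc (0 : ℝ) 1, lhPhi η t / ENNReal.ofReal t < ∞ := by
    have hint : IntegrableOn (fun t : ℝ => t ^ (η - 1)) (Set.Ioc 0 1) := by
      rw [← intervalIntegrable_iff_integrableOn_Ioc_of_le (by norm_num)]
      exact intervalIntegral.intervalIntegrable_rpow' (by linarith)
    refine lt_of_le_of_lt (setLIntegral_mono' measurableSet_Ioc ?_) hint.lintegral_lt_top
    intro t ht
    unfold lhPhi
    rw [← ENNReal.ofReal_div_of_pos ht.1, Real.rpow_sub_one ht.1.ne']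
    apply ENNReal.ofReal_le_ofReal
    have h0 := ht.1
    gcongr
    exact min_le_left _ _
  have h2 : ∫⁻ t in Set.Ioi (1 : ℝ), lhPhi η t / ENNReal.ofReal t < ∞ := by
    have hint : IntegrableOn (fun t : ℝ => t ^ (-η - 1)) (Set.Ioi 1) :=
      integrableOn_Ioi_rpow_of_lt (by linarith) (by norm_num)
    refine lt_of_le_of_lt (setLIntegral_mono' measurableSet_Ioi ?_) hint.lintegral_lt_top
    intro t ht
    have h0 : 0 < t := lt_trans one_pos ht
    unfold lhPhi
    rw [← ENNReal.ofReal_div_of_pos h0, Real.rpow_sub_one h0.ne', Real.rpow_neg h0.le,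
      ← Real.inv_rpow h0.le]
    apply ENNReal.ofReal_le_ofReal
    gcongr
    exact min_le_right _ _
  exact (ENNReal.add_lt_top.mpr ⟨h1, h2⟩).ne

lemma lh_block_le {X : Type*} [Norm X] (Ω : Set X) (a : ℝ) (q : ℝ≥0∞) (hq : 0 < q)
    (L : (X → ℝ) → ℝ≥0∞) (f : X → ℝ) (u : {u : ℤ // -1 ≤ u}) :
    lhW a u.1 * L ((annulus Ω u.1).indicator f) ≤ herzNormWith Ω a q L f := by
  unfold herzNormWith
  split_ifs with h
  · exact le_iSup (fun u : {u : ℤ // -1 ≤ u} =>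
      lhW a u.1 * L ((annulus Ω u.1).indicator f)) u
  · have hq' : 0 < q.toReal := ENNReal.toReal_pos hq.ne' h
    rw [ENNReal.le_rpow_inv_iff hq']
    exact ENNReal.le_tsum (f := fun u : {u : ℤ // -1 ≤ u} =>
      (lhW a u.1 * L ((annulus Ω u.1).indicator f)) ^ q.toReal) u

lemma lh_herz_le {X : Type*} [Norm X] (Ω : Set X) (a : ℝ) (q : ℝ≥0∞) (hq : 0 < q)
    (L : (X → ℝ) → ℝ≥0∞) (d e : ℝ) (hd : d ≠ 0) (he : 0 < e) :
    ∃ C : ℝ≥0∞, C ≠ ∞ ∧ ∀ t : ℝ, 0 < t → ∀ (A : ℝ≥0∞) (f : X → ℝ),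
      (∀ u : {u : ℤ // -1 ≤ u}, lhW a u.1 * L ((annulus Ω u.1).indicator f)
        ≤ A * lhPhi e (t / (2 : ℝ) ^ ((u.1 : ℝ) * d))) →
      herzNormWith Ω a q L f ≤ A * C := by
  by_cases h : q = ∞
  · refine ⟨1, by simp, fun t ht A f hA => ?_⟩
    unfold herzNormWith
    rw [if_pos h]
    refine iSup_le fun u => (hA u).trans ?_
    gcongr
    exact lhPhi_le_one _ _ (by positivity) he.le
  · have hq' : 0 < q.toReal := ENNReal.toReal_pos hq.ne' h
    obtain ⟨C, hC, hb⟩ := lh_sum_bound d (e * q.toReal) hd (by positivity)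
    refine ⟨C ^ q.toReal⁻¹, ENNReal.rpow_ne_top_of_nonneg (by positivity) hC,
      fun t ht A f hA => ?_⟩
    unfold herzNormWith
    rw [if_neg h]
    calc _ ≤ (A ^ q.toReal * C) ^ q.toReal⁻¹ := by
          apply ENNReal.rpow_le_rpow _ (by positivity)
          calc _ ≤ ∑' u : {u : ℤ // -1 ≤ u},
                A ^ q.toReal * lhPhi (e * q.toReal) (t / (2 : ℝ) ^ ((u.1 : ℝ) * d)) := by
                refine ENNReal.tsum_le_tsum fun u => ?_
                rw [← lhPhi_rpow _ _ _ (by positivity), ← ENNReal.mul_rpow_of_nonneg _ _ hq'.le]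
                exact ENNReal.rpow_le_rpow (hA u) hq'.le
            _ = A ^ q.toReal * _ := ENNReal.tsum_mul_left
            _ ≤ _ := by gcongr; exact hb t ht
      _ = _ := by
          rw [ENNReal.mul_rpow_of_nonneg _ _ (by positivity), ENNReal.rpow_rpow_inv hq'.ne']

lemma lh_annulus_meas {N : ℕ} (Ω : Set (Euc N)) (hΩ : MeasurableSet Ω) (u : ℤ) :
    MeasurableSet (annulus Ω u) := by
  unfold annulus
  split_ifs
  · exact hΩ.inter (measurableSet_lt measurable_norm measurable_const)
  · exact hΩ.inter ((measurableSet_le measurable_const measurable_norm).inter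
      (measurableSet_lt measurable_norm measurable_const))

lemma lh_annulus_lt {X : Type*} [Norm X] (Ω : Set X) (u : ℤ) (x : X) (hx : x ∈ annulus Ω u) :
    ‖x‖ < (2 : ℝ) ^ u ∧ (u ≠ -1 → (2 : ℝ) ^ (u - 1) ≤ ‖x‖) := by
  unfold annulus at hx
  split_ifs at hx with h
  · refine ⟨?_, fun h' => absurd h h'⟩
    have := hx.2
    rw [h]; norm_num; norm_num at this; linarith
  · exact ⟨hx.2.2, fun _ => hx.2.1⟩

lemma lh_annulus_inj {X : Type*} [Norm X] (Ω : Set X) (u v : ℤ) (hu : -1 ≤ u) (hv : -1 ≤ v)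
    (x : X) (hxu : x ∈ annulus Ω u) (hxv : x ∈ annulus Ω v) : u = v := by
  have key : ∀ u v : ℤ, -1 ≤ u → x ∈ annulus Ω u → x ∈ annulus Ω v → ¬ u < v := by
    intro u v hu hxu hxv h
    have h1 := (lh_annulus_lt Ω u x hxu).1
    have h2 := (lh_annulus_lt Ω v x hxv).2 (by omega)
    have h3 := (zpow_lt_zpow_iff_right₀ (by norm_num : (1 : ℝ) < 2)).mp (h2.trans_lt h1)
    omega
  have h1 := key u v hu hxu hxv
  have h2 := key v u hv hxv hxu
  omega

/-- The part of `f` on the annuli with `2^{ud} ≤ t`. -/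
def lhE {X : Type*} [Norm X] (Ω : Set X) (d t : ℝ) : Set X :=
  {x | ∃ u : {u : ℤ // -1 ≤ u}, (2 : ℝ) ^ ((u.1 : ℝ) * d) ≤ t ∧ x ∈ annulus Ω u.1}

lemma lhE_meas {N : ℕ} (Ω : Set (Euc N)) (hΩ : MeasurableSet Ω) (d t : ℝ) :
    MeasurableSet (lhE Ω d t) := by
  have : lhE Ω d t = ⋃ u : {u : ℤ // -1 ≤ u}, ⋃ _ : (2 : ℝ) ^ ((u.1 : ℝ) * d) ≤ t,
      annulus Ω u.1 := by
    ext x; simp [lhE]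
  rw [this]
  exact MeasurableSet.iUnion fun u => MeasurableSet.iUnion fun _ => lh_annulus_meas Ω hΩ u.1

lemma lhE_iff {X : Type*} [Norm X] (Ω : Set X) (d t : ℝ) (v : {u : ℤ // -1 ≤ u}) (x : X)
    (hx : x ∈ annulus Ω v.1) : x ∈ lhE Ω d t ↔ (2 : ℝ) ^ ((v.1 : ℝ) * d) ≤ t := by
  constructor
  · rintro ⟨u, hu, hxu⟩
    rwa [lh_annulus_inj Ω u.1 v.1 u.2 v.2 x hxu hx] at hu
  · intro h; exact ⟨v, h, hx⟩

lemma lh_K_lower {N : ℕ} (Ω : Set (Euc N)) (L : (Euc N → ℝ) → ℝ≥0∞) (κ : ℝ≥0∞)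
    (hκ0 : κ ≠ 0) (hκ : κ ≠ ∞) (hL : ∀ f g, L (f + g) ≤ κ * (L f + L g))
    (q₀ q₁ : ℝ≥0∞) (hq₀ : 0 < q₀) (hq₁ : 0 < q₁) (a₀ a₁ : ℝ) (f : Euc N → ℝ)
    (u : {u : ℤ // -1 ≤ u}) (t : ℝ) (ht : (2 : ℝ) ^ ((u.1 : ℝ) * (a₀ - a₁)) ≤ t) :
    κ⁻¹ * (lhW a₀ u.1 * L ((annulus Ω u.1).indicator f))
      ≤ Kfun (herzNormWith Ω a₀ q₀ L) (herzNormWith Ω a₁ q₁ L) t f := by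
  unfold Kfun
  refine le_iInf fun g => le_iInf fun _ => le_iInf fun _ => ?_
  rw [ENNReal.inv_mul_le_iff hκ0 hκ]
  have h1 : (annulus Ω u.1).indicator f
      = (annulus Ω u.1).indicator g + (annulus Ω u.1).indicator (f - g) := by
    rw [← Set.indicator_add']; congr 1; ext x; simp
  have hw : lhW a₀ u.1 ≤ ENNReal.ofReal t * lhW a₁ u.1 := by
    unfold lhW
    rw [← ENNReal.ofReal_mul (le_trans (by positivity) ht)]
    apply ENNReal.ofReal_le_ofReal
    calc (2 : ℝ) ^ ((u.1 : ℝ) * a₀) = (2 : ℝ) ^ ((u.1 : ℝ) * (a₀ - a₁)) * (2 : ℝ) ^ ((u.1 : ℝ) * a₁) := by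
          rw [← Real.rpow_add (by norm_num)]; congr 1; ring
      _ ≤ _ := by gcongr
  calc _ ≤ lhW a₀ u.1 * (κ * (L ((annulus Ω u.1).indicator g)
            + L ((annulus Ω u.1).indicator (f - g)))) := by
        rw [h1]; gcongr; exact hL _ _
    _ = κ * (lhW a₀ u.1 * L ((annulus Ω u.1).indicator g)
            + lhW a₀ u.1 * L ((annulus Ω u.1).indicator (f - g))) := by ring
    _ ≤ κ * (lhW a₀ u.1 * L ((annulus Ω u.1).indicator g)
            + ENNReal.ofReal t * (lhW a₁ u.1 * L ((annulus Ω u.1).indicator (f - g)))) := by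
        rw [← mul_assoc (ENNReal.ofReal t)]; gcongr
    _ ≤ _ := by
        gcongr
        · exact lh_block_le Ω a₀ q₀ hq₀ L g u
        · exact lh_block_le Ω a₁ q₁ hq₁ L (f - g) u

/-- The dominating sup. -/
noncomputable def lhS {X : Type*} [Norm X] (Ω : Set X) (L : (X → ℝ) → ℝ≥0∞) (a d e t : ℝ)
    (f : X → ℝ) : ℝ≥0∞ :=
  ⨆ u : {u : ℤ // -1 ≤ u}, lhW a u.1 * L ((annulus Ω u.1).indicator f)
    * lhPhi e (t / (2 : ℝ) ^ ((u.1 : ℝ) * d))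

lemma lh_term (a a' b d e t : ℝ) (u : ℤ) (ht : 0 < t) (F S : ℝ≥0∞)
    (hS : lhW a u * F * lhPhi e (t / (2 : ℝ) ^ ((u : ℝ) * d)) ≤ S)
    (h : (u : ℝ) * a' + 2 * e * |Real.logb 2 t - u * d| ≤ b * Real.logb 2 t + u * a) :
    lhW a' u * F ≤ ENNReal.ofReal (t ^ b) * S * lhPhi e (t / (2 : ℝ) ^ ((u : ℝ) * d)) := by
  set τ := Real.logb 2 t with hτ
  have htτ : t = (2 : ℝ) ^ τ := (Real.rpow_logb (by norm_num) (by norm_num) ht).symm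
  set P := lhPhi e (t / (2 : ℝ) ^ ((u : ℝ) * d)) with hP
  have hw : lhW a' u ≤ ENNReal.ofReal (t ^ b) * lhW a u * P * P := by
    rw [hP, htτ, ← Real.rpow_sub (by norm_num), lhPhi_two_rpow, lhW, lhW,
      ← ENNReal.ofReal_mul (by positivity), ← ENNReal.ofReal_mul (by positivity),
      ← ENNReal.ofReal_mul (by positivity), ← Real.rpow_mul (by norm_num),
      ← Real.rpow_add (by norm_num), ← Real.rpow_add (by norm_num), ← Real.rpow_add (by norm_num)]
    apply ENNReal.ofReal_le_ofReal
    apply Real.rpow_le_rpow_of_exponent_le (by norm_num)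
    linarith
  calc lhW a' u * F ≤ ENNReal.ofReal (t ^ b) * lhW a u * P * P * F := by gcongr
    _ = ENNReal.ofReal (t ^ b) * (lhW a u * F * P) * P := by ring
    _ ≤ _ := by gcongr

lemma lh_K_upper {N : ℕ} (Ω : Set (Euc N)) (hΩ : MeasurableSet Ω) (L : (Euc N → ℝ) → ℝ≥0∞)
    (hL0 : L 0 = 0) (θ : ℝ) (hθ0 : 0 < θ) (hθ1 : θ < 1)
    (q₀ q₁ : ℝ≥0∞) (hq₀ : 0 < q₀) (hq₁ : 0 < q₁) (a₀ a₁ a : ℝ) (ha01 : a₀ ≠ a₁)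
    (ha : a = (1 - θ) * a₀ + θ * a₁) :
    ∃ e : ℝ, 0 < e ∧ ∃ C : ℝ≥0∞, C ≠ ∞ ∧ ∀ t : ℝ, 0 < t → ∀ f : Euc N → ℝ, Measurable f →
      ENNReal.ofReal (t ^ (-θ)) * Kfun (herzNormWith Ω a₀ q₀ L) (herzNormWith Ω a₁ q₁ L) t f
        ≤ C * lhS Ω L a (a₀ - a₁) e t f := by
  set d := a₀ - a₁ with hd
  have hd0 : d ≠ 0 := sub_ne_zero.mpr ha01
  obtain ⟨e, he, he0, he1⟩ : ∃ e : ℝ, 0 < e ∧ 2 * e ≤ θ ∧ 2 * e ≤ 1 - θ := by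
    refine ⟨min θ (1 - θ) / 2, ?_, ?_, ?_⟩
    · have : 0 < min θ (1 - θ) := lt_min hθ0 (by linarith)
      linarith
    · have := min_le_left θ (1 - θ); linarith
    · have := min_le_right θ (1 - θ); linarith
  obtain ⟨C₀, hC₀, hb₀⟩ := lh_herz_le Ω a₀ q₀ hq₀ L d e hd0 he
  obtain ⟨C₁, hC₁, hb₁⟩ := lh_herz_le Ω a₁ q₁ hq₁ L d e hd0 he
  refine ⟨e, he, C₀ + C₁, ENNReal.add_ne_top.mpr ⟨hC₀, hC₁⟩, fun t ht f hf => ?_⟩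
  set S := lhS Ω L a d e t f with hS
  have hSu : ∀ u : {u : ℤ // -1 ≤ u}, lhW a u.1 * L ((annulus Ω u.1).indicator f)
    * lhPhi e (t / (2 : ℝ) ^ ((u.1 : ℝ) * d)) ≤ S := fun u =>
      le_iSup (fun u : {u : ℤ // -1 ≤ u} => lhW a u.1 * L ((annulus Ω u.1).indicator f)
    * lhPhi e (t / (2 : ℝ) ^ ((u.1 : ℝ) * d))) u
  have hlog : ∀ u : ℤ, (2 : ℝ) ^ ((u : ℝ) * d) ≤ t ↔ u * d ≤ Real.logb 2 t := fun u =>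
    (Real.le_logb_iff_rpow_le (by norm_num) ht).symm
  set E := lhE Ω d t with hE
  have hEm : MeasurableSet E := lhE_meas Ω hΩ d t
  have hfg : f - E.indicator f = Eᶜ.indicator f := by
    rw [Set.indicator_compl]
  have h0 : herzNormWith Ω a₀ q₀ L (E.indicator f) ≤ ENNReal.ofReal (t ^ θ) * S * C₀ := by
    refine hb₀ t ht _ _ fun u => ?_
    by_cases hu : (2 : ℝ) ^ ((u.1 : ℝ) * d) ≤ t
    · have : (annulus Ω u.1).indicator (E.indicator f) = (annulus Ω u.1).indicator f := by
        ext x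
        by_cases hx : x ∈ annulus Ω u.1
        · rw [Set.indicator_of_mem hx, Set.indicator_of_mem hx,
            Set.indicator_of_mem ((lhE_iff Ω d t u x hx).mpr hu)]
        · rw [Set.indicator_of_notMem hx, Set.indicator_of_notMem hx]
      rw [this]
      refine lh_term a a₀ θ d e t u.1 ht _ S (hSu u) ?_
      have h1 := (hlog u.1).mp hu
      rw [abs_of_nonneg (by linarith)]
      have h2 := mul_le_mul_of_nonneg_right he0 (sub_nonneg.mpr h1)
      have h3 : θ * Real.logb 2 t + u.1 * a = θ * (Real.logb 2 t - u.1 * d) + u.1 * a₀ := by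
        rw [ha, hd]; ring
      linarith
    · have : (annulus Ω u.1).indicator (E.indicator f) = 0 := by
        ext x
        by_cases hx : x ∈ annulus Ω u.1
        · rw [Set.indicator_of_mem hx,
            Set.indicator_of_notMem (fun h => hu ((lhE_iff Ω d t u x hx).mp h))]; rfl
        · rw [Set.indicator_of_notMem hx]; rfl
      rw [this, hL0, mul_zero]; exact bot_le
  have h1 : herzNormWith Ω a₁ q₁ L (f - E.indicator f)
      ≤ ENNReal.ofReal (t ^ (θ - 1)) * S * C₁ := by
    rw [hfg]
    refine hb₁ t ht _ _ fun u => ?_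
    by_cases hu : (2 : ℝ) ^ ((u.1 : ℝ) * d) ≤ t
    · have : (annulus Ω u.1).indicator (Eᶜ.indicator f) = 0 := by
        ext x
        by_cases hx : x ∈ annulus Ω u.1
        · rw [Set.indicator_of_mem hx,
            Set.indicator_of_notMem (Set.notMem_compl_iff.mpr ((lhE_iff Ω d t u x hx).mpr hu))]; rfl
        · rw [Set.indicator_of_notMem hx]; rfl
      rw [this, hL0, mul_zero]; exact bot_le
    · have : (annulus Ω u.1).indicator (Eᶜ.indicator f) = (annulus Ω u.1).indicator f := by
        ext x
        by_cases hx : x ∈ annulus Ω u.1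
        · rw [Set.indicator_of_mem hx, Set.indicator_of_mem hx,
            Set.indicator_of_mem (Set.mem_compl (fun h => hu ((lhE_iff Ω d t u x hx).mp h)))]
        · rw [Set.indicator_of_notMem hx, Set.indicator_of_notMem hx]
      rw [this]
      refine lh_term a a₁ (θ - 1) d e t u.1 ht _ S (hSu u) ?_
      have h1 := not_le.mp (fun h => hu ((hlog u.1).mpr h))
      rw [abs_of_nonpos (by linarith)]
      have h2 := mul_le_mul_of_nonneg_right he1 (sub_nonneg.mpr h1.le)
      have h3 : (θ - 1) * Real.logb 2 t + u.1 * a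
          = (1 - θ) * (u.1 * d - Real.logb 2 t) + u.1 * a₁ := by
        rw [ha, hd]; ring
      linarith
  have hK : Kfun (herzNormWith Ω a₀ q₀ L) (herzNormWith Ω a₁ q₁ L) t f
      ≤ herzNormWith Ω a₀ q₀ L (E.indicator f)
        + ENNReal.ofReal t * herzNormWith Ω a₁ q₁ L (f - E.indicator f) :=
    iInf_le_of_le (E.indicator f) (iInf_le_of_le (hf.indicator hEm)
      (iInf_le_of_le (hf.sub (hf.indicator hEm)) le_rfl))
  have e1 : ENNReal.ofReal (t ^ (-θ)) * ENNReal.ofReal (t ^ θ) = 1 := by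
    rw [← ENNReal.ofReal_mul (by positivity), ← Real.rpow_add ht]; simp
  have e2 : ENNReal.ofReal (t ^ (-θ)) * (ENNReal.ofReal t * ENNReal.ofReal (t ^ (θ - 1))) = 1 := by
    rw [← e1, ← ENNReal.ofReal_mul ht.le, Real.rpow_sub_one ht.ne']
    congr 2; field_simp
  calc _ ≤ ENNReal.ofReal (t ^ (-θ)) * (ENNReal.ofReal (t ^ θ) * S * C₀
          + ENNReal.ofReal t * (ENNReal.ofReal (t ^ (θ - 1)) * S * C₁)) := by
        gcongr; exact hK.trans (by gcongr)
    _ = (ENNReal.ofReal (t ^ (-θ)) * ENNReal.ofReal (t ^ θ)) * S * C₀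
        + (ENNReal.ofReal (t ^ (-θ)) * (ENNReal.ofReal t * ENNReal.ofReal (t ^ (θ - 1)))) * S * C₁ := by
        ring
    _ = _ := by rw [e1, e2]; ring

lemma lh_upper {N : ℕ} (Ω : Set (Euc N)) (hΩ : MeasurableSet Ω) (L : (Euc N → ℝ) → ℝ≥0∞)
    (hL0 : L 0 = 0) (θ : ℝ) (hθ0 : 0 < θ) (hθ1 : θ < 1)
    (q₀ q₁ q : ℝ≥0∞) (hq₀ : 0 < q₀) (hq₁ : 0 < q₁) (hq : 0 < q) (a₀ a₁ a : ℝ) (ha01 : a₀ ≠ a₁)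
    (ha : a = (1 - θ) * a₀ + θ * a₁) :
    ∃ C : ℝ≥0∞, C < ∞ ∧ ∀ f : Euc N → ℝ, Measurable f →
      interpNorm (herzNormWith Ω a₀ q₀ L) (herzNormWith Ω a₁ q₁ L) θ q f
        ≤ C * herzNormWith Ω a q L f := by
  obtain ⟨e, he, C, hC, hK⟩ := lh_K_upper Ω hΩ L hL0 θ hθ0 hθ1 q₀ q₁ hq₀ hq₁ a₀ a₁ a ha01 ha
  set d := a₀ - a₁ with hd
  by_cases h : q = ∞
  · refine ⟨C, hC.lt_top, fun f hf => ?_⟩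
    unfold interpNorm
    rw [if_pos h]
    refine iSup_le fun t => (hK t.1 t.2 f hf).trans ?_
    gcongr
    refine iSup_le fun u => ?_
    have ht := t.2
    calc _ ≤ lhW a u.1 * L ((annulus Ω u.1).indicator f) * 1 := by
          gcongr; exact lhPhi_le_one _ _ (by positivity) he.le
      _ ≤ _ := by rw [mul_one]; exact lh_block_le Ω a q hq L f u
  · have hq' : 0 < q.toReal := ENNReal.toReal_pos hq.ne' h
    set σ := q.toReal with hσ
    set I := ∫⁻ t in Set.Ioi (0 : ℝ), lhPhi (e * σ) t / ENNReal.ofReal t with hI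
    have hIt : I ≠ ∞ := lh_int_bound (e * σ) (by positivity)
    refine ⟨C * I ^ σ⁻¹, (ENNReal.mul_ne_top hC
      (ENNReal.rpow_ne_top_of_nonneg (by positivity) hIt)).lt_top, fun f hf => ?_⟩
    unfold interpNorm
    rw [if_neg h]
    set B : {u : ℤ // -1 ≤ u} → ℝ≥0∞ := fun u => lhW a u.1 * L ((annulus Ω u.1).indicator f) with hB
    have hherz : herzNormWith Ω a q L f = (∑' u, B u ^ σ) ^ σ⁻¹ := by
      unfold herzNormWith; rw [if_neg h]; rfl
    rw [hherz]
    have hpt : ∀ t ∈ Set.Ioi (0 : ℝ),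
        (ENNReal.ofReal (t ^ (-θ)) * Kfun (herzNormWith Ω a₀ q₀ L) (herzNormWith Ω a₁ q₁ L) t f) ^ σ
          / ENNReal.ofReal t
        ≤ C ^ σ * ∑' u, B u ^ σ * (lhPhi (e * σ) (((2 : ℝ) ^ ((u.1 : ℝ) * d))⁻¹ * t)
          / ENNReal.ofReal t) := by
      intro t ht
      have ht' : 0 < t := ht
      have hSle : lhS Ω L a d e t f ^ σ
          ≤ ∑' u, B u ^ σ * lhPhi (e * σ) (((2 : ℝ) ^ ((u.1 : ℝ) * d))⁻¹ * t) := by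
        rw [← ENNReal.le_rpow_inv_iff hq']
        refine iSup_le fun u => ?_
        rw [ENNReal.le_rpow_inv_iff hq', ENNReal.mul_rpow_of_nonneg _ _ hq'.le,
          lhPhi_rpow _ _ _ (by positivity), div_eq_inv_mul]
        exact ENNReal.le_tsum
          (f := fun u => B u ^ σ * lhPhi (e * σ) (((2 : ℝ) ^ ((u.1 : ℝ) * d))⁻¹ * t)) u
      calc _ ≤ (C * lhS Ω L a d e t f) ^ σ / ENNReal.ofReal t := by
            exact ENNReal.div_le_div_right (ENNReal.rpow_le_rpow (hK t ht f hf) hq'.le) _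
        _ = C ^ σ * (lhS Ω L a d e t f ^ σ / ENNReal.ofReal t) := by
            rw [ENNReal.mul_rpow_of_nonneg _ _ hq'.le, mul_div_assoc]
        _ ≤ C ^ σ * ((∑' u, B u ^ σ * lhPhi (e * σ) (((2 : ℝ) ^ ((u.1 : ℝ) * d))⁻¹ * t))
              / ENNReal.ofReal t) := by gcongr
        _ = _ := by
            rw [div_eq_mul_inv, ← ENNReal.tsum_mul_right]
            simp_rw [div_eq_mul_inv, mul_assoc]
    have hint : ∫⁻ t in Set.Ioi (0 : ℝ),
        (ENNReal.ofReal (t ^ (-θ)) * Kfun (herzNormWith Ω a₀ q₀ L) (herzNormWith Ω a₁ q₁ L) t f) ^ σ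
          / ENNReal.ofReal t ≤ C ^ σ * ((∑' u, B u ^ σ) * I) := by
      refine (setLIntegral_mono' measurableSet_Ioi hpt).trans ?_
      have hm : ∀ c : ℝ, Measurable (fun t : ℝ => lhPhi (e * σ) (c * t) / ENNReal.ofReal t) := by
        intro c; unfold lhPhi; fun_prop
      rw [lintegral_const_mul' _ _ (ENNReal.rpow_ne_top_of_nonneg hq'.le hC),
        lintegral_tsum (fun u => ((hm _).const_mul _).aemeasurable), ← ENNReal.tsum_mul_right]
      gcongr with u
      rw [lintegral_const_mul _ (hm _), lh_scale (lhPhi (e * σ)) _ (by positivity)]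
    refine (ENNReal.rpow_le_rpow hint (by positivity)).trans (le_of_eq ?_)
    rw [ENNReal.mul_rpow_of_nonneg _ _ (by positivity), ENNReal.mul_rpow_of_nonneg _ _ (by positivity),
      ENNReal.rpow_rpow_inv hq'.ne']
    ring

lemma lh_lower {N : ℕ} (Ω : Set (Euc N)) (L : (Euc N → ℝ) → ℝ≥0∞) (κ : ℝ≥0∞)
    (hκ0 : κ ≠ 0) (hκ : κ ≠ ∞) (hL : ∀ f g, L (f + g) ≤ κ * (L f + L g))
    (θ : ℝ) (hθ0 : 0 < θ)
    (q₀ q₁ q : ℝ≥0∞) (hq₀ : 0 < q₀) (hq₁ : 0 < q₁) (hq : 0 < q) (a₀ a₁ a : ℝ) (ha01 : a₀ ≠ a₁)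
    (ha : a = (1 - θ) * a₀ + θ * a₁) :
    ∃ c : ℝ≥0∞, 0 < c ∧ ∀ f : Euc N → ℝ,
      c * herzNormWith Ω a q L f
        ≤ interpNorm (herzNormWith Ω a₀ q₀ L) (herzNormWith Ω a₁ q₁ L) θ q f := by
  set d := a₀ - a₁ with hd
  have hd0 : 0 < |d| := abs_pos.mpr (sub_ne_zero.mpr ha01)
  set D : ℝ≥0∞ := ENNReal.ofReal ((2 : ℝ) ^ (-(θ * |d|))) with hD
  have hDpos : D ≠ 0 := by
    simp only [hD, ne_eq, ENNReal.ofReal_eq_zero, not_le]; positivity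
  have hκi : κ⁻¹ ≠ 0 := ENNReal.inv_ne_zero.mpr hκ
  have key : ∀ (f : Euc N → ℝ) (u : {u : ℤ // -1 ≤ u}) (t : ℝ),
      t ∈ Set.Ico ((2 : ℝ) ^ ((u.1 : ℝ) * d)) ((2 : ℝ) ^ ((u.1 : ℝ) * d + |d|)) →
      D * κ⁻¹ * (lhW a u.1 * L ((annulus Ω u.1).indicator f))
        ≤ ENNReal.ofReal (t ^ (-θ)) *
          Kfun (herzNormWith Ω a₀ q₀ L) (herzNormWith Ω a₁ q₁ L) t f := by
    intro f u t ht
    have ht0 : 0 < t := lt_of_lt_of_le (by positivity) ht.1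
    have h1 := lh_K_lower Ω L κ hκ0 hκ hL q₀ q₁ hq₀ hq₁ a₀ a₁ f u t ht.1
    have hw : D * lhW a u.1 ≤ ENNReal.ofReal (t ^ (-θ)) * lhW a₀ u.1 := by
      unfold lhW
      rw [hD, ← ENNReal.ofReal_mul (by positivity), ← ENNReal.ofReal_mul (by positivity)]
      apply ENNReal.ofReal_le_ofReal
      have h2 : ((2 : ℝ) ^ ((u.1 : ℝ) * d + |d|)) ^ (-θ) ≤ t ^ (-θ) :=
        Real.rpow_le_rpow_of_nonpos ht0 ht.2.le (by linarith)
      calc _ = ((2 : ℝ) ^ ((u.1 : ℝ) * d + |d|)) ^ (-θ) * (2 : ℝ) ^ ((u.1 : ℝ) * a₀) := by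
            rw [← Real.rpow_mul (by norm_num), ← Real.rpow_add (by norm_num),
              ← Real.rpow_add (by norm_num)]
            congr 1; rw [ha, hd]; ring
        _ ≤ _ := by gcongr
    calc _ = (D * lhW a u.1) * (κ⁻¹ * L ((annulus Ω u.1).indicator f)) := by ring
      _ ≤ (ENNReal.ofReal (t ^ (-θ)) * lhW a₀ u.1) * (κ⁻¹ * L ((annulus Ω u.1).indicator f)) := by
          gcongr
      _ = ENNReal.ofReal (t ^ (-θ)) * (κ⁻¹ * (lhW a₀ u.1 * L ((annulus Ω u.1).indicator f))) := by
          ring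
      _ ≤ _ := by gcongr
  by_cases h : q = ∞
  · refine ⟨D * κ⁻¹, pos_iff_ne_zero.mpr (mul_ne_zero hDpos hκi), fun f => ?_⟩
    unfold interpNorm
    rw [if_pos h]
    unfold herzNormWith
    rw [if_pos h, ENNReal.mul_iSup]
    refine iSup_le fun u => ?_
    refine (key f u ((2 : ℝ) ^ ((u.1 : ℝ) * d)) ⟨le_rfl, ?_⟩).trans ?_
    · exact Real.rpow_lt_rpow_of_exponent_lt (by norm_num) (by linarith)
    · exact le_iSup (fun t : {t : ℝ // 0 < t} => ENNReal.ofReal (t.1 ^ (-θ)) *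
        Kfun (herzNormWith Ω a₀ q₀ L) (herzNormWith Ω a₁ q₁ L) t.1 f)
        ⟨(2 : ℝ) ^ ((u.1 : ℝ) * d), by positivity⟩
  · have hq' : 0 < q.toReal := ENNReal.toReal_pos hq.ne' h
    set σ := q.toReal with hσ
    set Λ : ℝ≥0∞ := ENNReal.ofReal (1 - (2 : ℝ) ^ (-|d|)) with hΛ
    have hΛ0 : Λ ≠ 0 := by
      have : (2 : ℝ) ^ (-|d|) < 1 :=
        Real.rpow_lt_one_of_one_lt_of_neg (by norm_num) (by linarith)
      simp only [hΛ, ne_eq, ENNReal.ofReal_eq_zero, not_le]; linarith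
    refine ⟨D * κ⁻¹ * Λ ^ σ⁻¹, pos_iff_ne_zero.mpr (mul_ne_zero (mul_ne_zero hDpos hκi) ?_),
      fun f => ?_⟩
    · exact (ENNReal.rpow_pos (pos_iff_ne_zero.mpr hΛ0) ENNReal.ofReal_ne_top).ne'
    set B : {u : ℤ // -1 ≤ u} → ℝ≥0∞ := fun u => lhW a u.1 * L ((annulus Ω u.1).indicator f) with hB
    have hherz : herzNormWith Ω a q L f = (∑' u, B u ^ σ) ^ σ⁻¹ := by
      unfold herzNormWith; rw [if_neg h]; rfl
    rw [hherz]
    unfold interpNorm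
    rw [if_neg h]
    set G : ℝ → ℝ≥0∞ := fun t => (ENNReal.ofReal (t ^ (-θ)) *
        Kfun (herzNormWith Ω a₀ q₀ L) (herzNormWith Ω a₁ q₁ L) t f) ^ σ / ENNReal.ofReal t with hG
    set J : {u : ℤ // -1 ≤ u} → Set ℝ := fun u =>
      Set.Ico ((2 : ℝ) ^ ((u.1 : ℝ) * d)) ((2 : ℝ) ^ ((u.1 : ℝ) * d + |d|)) with hJ
    have hdisj : Pairwise (Function.onFun Disjoint J) := by
      intro u v huv
      rw [Function.onFun, Set.disjoint_left]
      rintro t ⟨h1, h2⟩ ⟨h3, h4⟩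
      apply huv
      have i1 := (Real.rpow_lt_rpow_left_iff (by norm_num : (1 : ℝ) < 2)).mp (h1.trans_lt h4)
      have i2 := (Real.rpow_lt_rpow_left_iff (by norm_num : (1 : ℝ) < 2)).mp (h3.trans_lt h2)
      have i3 : |((u.1 : ℝ) - v.1) * d| < |d| := by
        rw [abs_lt]; constructor <;> linarith
      rw [abs_mul] at i3
      have i4 : |(u.1 : ℝ) - v.1| < 1 := by
        by_contra! hcon
        have := mul_le_mul_of_nonneg_right hcon hd0.le
        linarith
      have i5 : |u.1 - v.1| < 1 := by exact_mod_cast i4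
      have i6 := Int.abs_lt_one_iff.mp i5
      exact Subtype.ext (by omega)
    have hJint : ∀ u, (D * κ⁻¹ * B u) ^ σ * Λ ≤ ∫⁻ t in J u, G t := by
      intro u
      set s : ℝ := (2 : ℝ) ^ ((u.1 : ℝ) * d + |d|) with hs
      have hs0 : 0 < s := by positivity
      have hvol : volume (J u) = ENNReal.ofReal s * Λ := by
        rw [hJ]
        simp only
        rw [Real.volume_Ico, hΛ, ← ENNReal.ofReal_mul hs0.le]
        congr 1
        rw [mul_sub s, mul_one, hs, ← Real.rpow_add (by norm_num)]
        congr 2; ring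
      calc (D * κ⁻¹ * B u) ^ σ * Λ = ((D * κ⁻¹ * B u) ^ σ / ENNReal.ofReal s) * volume (J u) := by
            rw [hvol, ← mul_assoc (_ / _), ENNReal.div_mul_cancel (by simpa using hs0) ENNReal.ofReal_ne_top]
        _ = ∫⁻ _ in J u, (D * κ⁻¹ * B u) ^ σ / ENNReal.ofReal s := by
            rw [setLIntegral_const]
        _ ≤ _ := by
            apply setLIntegral_mono' measurableSet_Ico
            intro t ht
            rw [hG]
            simp only
            exact ENNReal.div_le_div (ENNReal.rpow_le_rpow (key f u t ht) hq'.le)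
              (ENNReal.ofReal_le_ofReal ht.2.le)
    have hsum : (D * κ⁻¹) ^ σ * (∑' u, B u ^ σ) * Λ ≤ ∫⁻ t in Set.Ioi (0 : ℝ), G t := by
      calc _ = ∑' u, (D * κ⁻¹ * B u) ^ σ * Λ := by
            rw [← ENNReal.tsum_mul_left, ← ENNReal.tsum_mul_right]
            simp_rw [ENNReal.mul_rpow_of_nonneg _ _ hq'.le]
        _ ≤ ∑' u, ∫⁻ t in J u, G t := ENNReal.tsum_le_tsum hJint
        _ = ∫⁻ t in ⋃ u, J u, G t := (lintegral_iUnion (fun u => measurableSet_Ico) hdisj G).symm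
        _ ≤ _ := by
            apply lintegral_mono_set
            apply Set.iUnion_subset
            intro u t ht
            exact lt_of_lt_of_le (by positivity) ht.1
    refine le_trans (le_of_eq ?_) (ENNReal.rpow_le_rpow hsum (by positivity))
    rw [ENNReal.mul_rpow_of_nonneg _ _ (by positivity), ENNReal.mul_rpow_of_nonneg _ _ (by positivity),
      ENNReal.rpow_rpow_inv hq'.ne']
    ring

/-- (Real interpolation, different weights.) Let `0 < θ < 1`,
`0 < p < ∞`, `0 < q₀, q₁, q, r ≤ ∞`, `a₀ ≠ a₁` and `a = (1−θ)a₀ + θa₁`.  Then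
`(HL^{a₀,r}_{p,q₀}, HL^{a₁,r}_{p,q₁})_{θ,q} = HL^{a,r}_{p,q}` with equivalent
quasi-norms on `X₀ + X₁`. -/
theorem lorentzHerz_interp_weights {N : ℕ} (hN : 1 ≤ N)
    (Ω : Set (Euc N)) (hΩ : MeasurableSet Ω)
    (θ : ℝ) (hθ0 : 0 < θ) (hθ1 : θ < 1)
    (p q₀ q₁ q r : ℝ≥0∞) (hp0 : 0 < p) (hp : p ≠ ∞)
    (hq₀ : 0 < q₀) (hq₁ : 0 < q₁) (hq : 0 < q) (hr : 0 < r)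
    (a₀ a₁ a : ℝ) (ha01 : a₀ ≠ a₁) (ha : a = (1 - θ) * a₀ + θ * a₁) :
    ∃ c C : ℝ≥0∞, 0 < c ∧ C < ∞ ∧ ∀ f : Euc N → ℝ, Measurable f →
      inSum (herzNorm volume Ω a₀ p q₀ r) (herzNorm volume Ω a₁ p q₁ r) f →
      c * herzNorm volume Ω a p q r f
          ≤ interpNorm (herzNorm volume Ω a₀ p q₀ r) (herzNorm volume Ω a₁ p q₁ r) θ q f
      ∧ interpNorm (herzNorm volume Ω a₀ p q₀ r) (herzNorm volume Ω a₁ p q₁ r) θ q f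
          ≤ C * herzNorm volume Ω a p q r f := by
  obtain ⟨κ, hκ0, hκ, hL⟩ := lh_quasi (volume : Measure (Euc N)) p r hr
  obtain ⟨c, hc, hlow⟩ := lh_lower Ω (lorentzNorm volume p r) κ hκ0 hκ hL θ hθ0 q₀ q₁ q
    hq₀ hq₁ hq a₀ a₁ a ha01 ha
  obtain ⟨C, hC, hup⟩ := lh_upper Ω hΩ (lorentzNorm volume p r) (lh_lorentz_zero volume p r hr)
    θ hθ0 hθ1 q₀ q₁ q hq₀ hq₁ hq a₀ a₁ a ha01 ha
  exact ⟨c, C, hc, hC, fun f hf _ => ⟨hlow f, hup f hf⟩⟩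
end
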